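/- arXiv:math/9612223 — 3 statements merged into one kernel-verified Lean document; each statement's English description precedes it below -/
import Mathlib

section
/- The Erdős measure μ is quasi-invariant and ergodic with respect to both T and the rotation R: for every Borel set E ⊆ [0,1), μ(E) = 0 if and only if μ(T⁻¹E) = 0, and μ(E) = 0 if and only if μ(R⁻¹E) = 0; moreover, every Borel set E with T⁻¹E = E satisfies μ(E) ∈ {0,1}, and every Borel set E with R⁻¹E = E satisfies μ(E) ∈ {0,1}. -/
open MeasureTheory Filter Topology
open scoped ENNReal

/-- The golden ratio λ = (1+√5)/2. -/
noncomputable def gold : ℝ := (1 + Real.sqrt 5) / 2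

/-- `p` is the Bernoulli (1/2,1/2) product measure on `{0,1}^ℕ`, characterized by its
values on cylinder sets. -/
def IsCoinMeasure (p : Measure (ℕ → Bool)) : Prop :=
  ∀ (s : Finset ℕ) (b : ℕ → Bool), p {ε | ∀ i ∈ s, ε i = b i} = (2 : ℝ≥0∞)⁻¹ ^ s.card

/-- π(ε) = Σ_{k=1}^∞ ε_k λ^{-k-1} (indices shifted so that `ε k` is `ε_{k+1}`). -/
noncomputable def piMap (ε : ℕ → Bool) : ℝ := ∑' k : ℕ, if ε k then gold⁻¹ ^ (k + 2) else 0

/-- The Erdős measure: the pushforward of the coin measure `p` under `piMap`. -/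
noncomputable def erdosOf (p : Measure (ℕ → Bool)) : Measure ℝ := p.map piMap

/-! ### The inverse of the golden ratio -/

lemma gold_inv_pos : 0 < gold⁻¹ := by
  unfold gold
  positivity

lemma gold_eq : gold = 1 + gold⁻¹ := by
  have h : gold ≠ 0 := (inv_pos.1 gold_inv_pos).ne'
  have h5 : Real.sqrt 5 ^ 2 = 5 := Real.sq_sqrt (by norm_num)
  have hsq : gold * gold = gold + 1 := by
    unfold gold
    nlinarith
  field_simp
  nlinarith

lemma gold_mul_inv : gold * gold⁻¹ = 1 :=
  mul_inv_cancel₀ (inv_pos.1 gold_inv_pos).ne'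

lemma gold_inv_sq : gold⁻¹ ^ 2 = 1 - gold⁻¹ := by
  have h := gold_mul_inv
  nth_rewrite 1 [gold_eq] at h
  linarith

lemma gold_inv_lt_one : gold⁻¹ < 1 := by
  nlinarith [gold_inv_sq, gold_inv_pos]

/-! ### The coin measure -/

/-- Flip the coordinates lying in `s`. -/
def flipOn (s : Finset ℕ) (ε : ℕ → Bool) : ℕ → Bool := fun i => xor (ε i) (decide (i ∈ s))

/-- Flip all coordinates. -/
def flipAll (ε : ℕ → Bool) : ℕ → Bool := fun i => !ε i

/-- Forget the first coordinate. -/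
def shift (ε : ℕ → Bool) : ℕ → Bool := fun i => ε (i + 1)

/-- Prepend a coordinate. -/
def prepend (b : Bool) (ε : ℕ → Bool) : ℕ → Bool
  | 0 => b
  | n + 1 => ε n

lemma measurableSet_cylinder (s : Finset ℕ) (b : ℕ → Bool) :
    MeasurableSet {ε : ℕ → Bool | ∀ i ∈ s, ε i = b i} := by
  have : {ε : ℕ → Bool | ∀ i ∈ s, ε i = b i} = ⋂ i ∈ s, (fun ε : ℕ → Bool => ε i) ⁻¹' {b i} := by
    ext
    simp
  rw [this]
  exact Finset.measurableSet_biInter _ fun i _ => measurable_pi_apply i (measurableSet_singleton _)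

lemma measurable_flipOn (s : Finset ℕ) : Measurable (flipOn s) :=
  measurable_pi_lambda _ fun i =>
    (measurable_of_countable fun b : Bool => xor b (decide (i ∈ s))).comp (measurable_pi_apply i)

lemma measurable_shift : Measurable shift :=
  measurable_pi_lambda _ fun i => measurable_pi_apply (i + 1)

lemma flipOn_flipOn (s : Finset ℕ) (ε : ℕ → Bool) : flipOn s (flipOn s ε) = ε := by
  funext i
  simp [flipOn]

lemma exists_flipOn_eq {ε δ : ℕ → Bool} {N : ℕ} (h : ∀ i ≥ N, δ i = ε i) :
    ∃ s, flipOn s ε = δ := by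
  refine ⟨(Finset.range N).filter fun i => δ i ≠ ε i, ?_⟩
  funext i
  by_cases hi : i < N
  · cases h1 : δ i <;> cases h2 : ε i <;> simp [flipOn, hi, h1, h2]
  · simp [flipOn, hi, h i (not_lt.1 hi)]

namespace IsCoinMeasure

variable {p q : Measure (ℕ → Bool)}

lemma isProbabilityMeasure (hp : IsCoinMeasure p) : IsProbabilityMeasure p :=
  ⟨by simpa using hp ∅ fun _ => true⟩

lemma unique (hp : IsCoinMeasure p) (hq : IsCoinMeasure q) : p = q := by
  have := hp.isProbabilityMeasure
  have hm (I : Finset ℕ) : Measurable (I.restrict : (ℕ → Bool) → I → Bool) := by fun_prop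
  refine IsProjectiveLimit.unique (P := fun I : Finset ℕ => p.map I.restrict) (fun I => rfl)
    fun I => Measure.ext_of_singleton fun a => ?_
  have h : (I.restrict : (ℕ → Bool) → I → Bool) ⁻¹' {a} =
      {ε | ∀ i ∈ I, ε i = if hi : i ∈ I then a ⟨i, hi⟩ else true} := by
    ext ε
    simp only [Set.mem_preimage, Set.mem_singleton_iff, Set.mem_ofPred_eq, funext_iff,
      Subtype.forall, Finset.restrict]
    exact forall₂_congr fun i hi => by simp [hi]
  rw [Measure.map_apply (hm I) (measurableSet_singleton a),
    Measure.map_apply (hm I) (measurableSet_singleton a), h, hp, hq]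

lemma measurePreserving_flipOn (hp : IsCoinMeasure p) (s : Finset ℕ) :
    MeasurePreserving (flipOn s) p p := by
  refine ⟨measurable_flipOn s, unique (fun t b => ?_) hp⟩
  rw [Measure.map_apply (measurable_flipOn s) (measurableSet_cylinder t b), ← hp t (flipOn s b)]
  congr 1
  ext ε
  refine forall₂_congr fun i _ => ?_
  cases h1 : ε i <;> cases h2 : b i <;> cases h3 : decide (i ∈ s) <;> simp [flipOn, h1, h2, h3]

lemma measurePreserving_shift (hp : IsCoinMeasure p) : MeasurePreserving shift p p := by
  refine ⟨measurable_shift, unique (fun t b => ?_) hp⟩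
  rw [Measure.map_apply measurable_shift (measurableSet_cylinder t b)]
  have h := hp (t.map ⟨Nat.succ, Nat.succ_injective⟩) (prepend true b)
  rw [Finset.card_map] at h
  rw [← h]
  congr 1
  ext ε
  simp [shift, prepend]

lemma ae_ne (hp : IsCoinMeasure p) (b : ℕ → Bool) : ∀ᵐ ε ∂p, ε ≠ b := by
  have h0 : p {b} = 0 := by
    refine le_antisymm (ge_of_tendsto' (ENNReal.tendsto_pow_atTop_nhds_zero_of_lt_one
      (r := (2 : ℝ≥0∞)⁻¹) (by simp)) fun n => ?_) zero_le
    calc p {b} ≤ p {ε | ∀ i ∈ Finset.range n, ε i = b i} := measure_mono (by simp)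
      _ = _ := by rw [hp, Finset.card_range]
  exact measure_eq_zero_iff_ae_notMem.1 h0

/-- A probability measure invariant under all coordinate flips is the coin measure. -/
lemma of_flipOn_invariant [IsProbabilityMeasure q]
    (h : ∀ i, q.map (flipOn {i}) = q) : IsCoinMeasure q := by
  intro s b
  induction s using Finset.induction_on with
  | empty => simp
  | insert a s ha ih =>
    have hflip : q {ε | ∀ i ∈ insert a s, ε i = flipOn {a} b i} =
        q {ε | ∀ i ∈ insert a s, ε i = b i} := by
      nth_rewrite 2 [← h a]
      rw [Measure.map_apply (measurable_flipOn _) (measurableSet_cylinder _ _)]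
      congr 1
      ext ε
      refine forall₂_congr fun i _ => ?_
      cases h1 : ε i <;> cases h2 : b i <;> cases h3 : decide (i = a) <;>
        simp_all [flipOn]
    have hunion : {ε : ℕ → Bool | ∀ i ∈ s, ε i = b i} =
        {ε | ∀ i ∈ insert a s, ε i = b i} ∪ {ε | ∀ i ∈ insert a s, ε i = flipOn {a} b i} := by
      ext ε
      have hs : (∀ i ∈ s, ε i = flipOn {a} b i) ↔ ∀ i ∈ s, ε i = b i :=
        forall₂_congr fun i hi => by simp [flipOn, ne_of_mem_of_not_mem hi ha]
      simp only [Set.mem_ofPred_eq, Set.mem_union, Finset.forall_mem_insert, hs]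
      cases h1 : ε a <;> cases h2 : b a <;> simp [flipOn, h2]
    have hdisj : Disjoint {ε : ℕ → Bool | ∀ i ∈ insert a s, ε i = b i}
        {ε | ∀ i ∈ insert a s, ε i = flipOn {a} b i} := by
      rw [Set.disjoint_left]
      intro ε h1 h2
      have h3 := h1 a (Finset.mem_insert_self a s)
      have h4 := h2 a (Finset.mem_insert_self a s)
      rw [h3] at h4
      simp [flipOn] at h4
    rw [hunion, measure_union hdisj (measurableSet_cylinder _ _), hflip, ← two_mul] at ih
    rw [Finset.card_insert_of_notMem ha, pow_succ', ← ih, ← mul_assoc,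
      ENNReal.inv_mul_cancel two_ne_zero ENNReal.ofNat_ne_top, one_mul]

/-- A zero-one law for events invariant under coordinate flips. -/
lemma zero_or_one (hp : IsCoinMeasure p) {A : Set (ℕ → Bool)} (hA : MeasurableSet A)
    (h : ∀ i ε, flipOn {i} ε ∈ A ↔ ε ∈ A) : p A = 0 ∨ p A = 1 := by
  have := hp.isProbabilityMeasure
  refine or_iff_not_imp_left.2 fun h0 => ?_
  have hprob : IsProbabilityMeasure (ProbabilityTheory.cond p A) :=
    ProbabilityTheory.cond_isProbabilityMeasure h0
  have hcoin : IsCoinMeasure (ProbabilityTheory.cond p A) := by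
    refine of_flipOn_invariant fun i => ?_
    ext B hB
    rw [Measure.map_apply (measurable_flipOn _) hB, ProbabilityTheory.cond_apply hA,
      ProbabilityTheory.cond_apply hA,
      ← (hp.measurePreserving_flipOn {i}).measure_preimage (hA.inter hB).nullMeasurableSet,
      Set.preimage_inter]
    congr 3
    ext ε
    exact (h i ε).symm
  rw [← hcoin.unique hp, ProbabilityTheory.cond_apply hA, Set.inter_self]
  exact ENNReal.inv_mul_cancel h0 (measure_ne_top _ _)

end IsCoinMeasure

/-! ### The coding map -/

lemma summable_piMap (ε : ℕ → Bool) :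
    Summable fun k : ℕ => if ε k then gold⁻¹ ^ (k + 2) else 0 := by
  have hβ := gold_inv_pos
  refine Summable.of_nonneg_of_le (fun k => ?_) (fun k => ?_)
    ((summable_nat_add_iff 2).2 (summable_geometric_of_lt_one hβ.le gold_inv_lt_one))
  · split_ifs <;> positivity
  · split_ifs
    · exact le_rfl
    · positivity

lemma measurable_piMap : Measurable piMap := by
  have hβ := gold_inv_pos
  refine Continuous.measurable ?_
  refine continuous_tsum (u := fun k => gold⁻¹ ^ (k + 2)) (fun k => ?_)
    ((summable_nat_add_iff 2).2 (summable_geometric_of_lt_one hβ.le gold_inv_lt_one))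
    fun k ε => ?_
  · exact (continuous_of_discreteTopology (f := fun b : Bool =>
      if b then gold⁻¹ ^ (k + 2) else 0)).comp (continuous_apply k)
  · split_ifs
    · rw [Real.norm_of_nonneg (by positivity)]
    · rw [norm_zero]
      positivity

lemma piMap_eq_shift (ε : ℕ → Bool) :
    piMap ε = (if ε 0 then gold⁻¹ ^ 2 else 0) + gold⁻¹ * piMap (shift ε) := by
  unfold piMap
  rw [(summable_piMap ε).tsum_eq_zero_add, ← tsum_mul_left]
  congr 1
  refine tsum_congr fun k => ?_
  cases h : ε (k + 1)
  · simp [shift, h]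
  · simp only [shift, h, if_true]
    ring

lemma piMap_prepend (b : Bool) (ε : ℕ → Bool) :
    piMap (prepend b ε) = (if b then gold⁻¹ ^ 2 else 0) + gold⁻¹ * piMap ε :=
  piMap_eq_shift _

lemma gold_mul_piMap (ε : ℕ → Bool) :
    gold * piMap ε = (if ε 0 then gold⁻¹ else 0) + piMap (shift ε) := by
  rw [piMap_eq_shift ε, mul_add, ← mul_assoc, gold_mul_inv, one_mul, mul_ite, mul_zero, sq,
    ← mul_assoc, gold_mul_inv, one_mul]

lemma piMap_nonneg (ε : ℕ → Bool) : 0 ≤ piMap ε :=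
  tsum_nonneg fun k => by
    have hβ := gold_inv_pos
    split_ifs <;> positivity

lemma piMap_add_flipAll (ε : ℕ → Bool) : piMap ε + piMap (flipAll ε) = 1 := by
  have hβ := gold_inv_pos
  have h1 : (1 - gold⁻¹)⁻¹ * gold⁻¹ ^ 2 = 1 := by
    rw [gold_inv_sq]
    exact inv_mul_cancel₀ (by linarith [gold_inv_lt_one])
  unfold piMap
  rw [← (summable_piMap ε).tsum_add (summable_piMap (flipAll ε)), ← h1,
    ← tsum_geometric_of_lt_one hβ.le gold_inv_lt_one, ← tsum_mul_right]
  refine tsum_congr fun k => ?_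
  cases h : ε k <;> simp [flipAll, h, pow_add]

lemma piMap_lt_one {ε : ℕ → Bool} (h : ε ≠ fun _ => true) : piMap ε < 1 := by
  have hβ := gold_inv_pos
  obtain ⟨k, hk⟩ := Function.ne_iff.1 h
  have hle : gold⁻¹ ^ (k + 2) ≤ piMap (flipAll ε) := by
    have := (summable_piMap (flipAll ε)).le_tsum k fun j _ => by split_ifs <;> positivity
    simpa [piMap, flipAll, hk] using this
  have : 0 < gold⁻¹ ^ (k + 2) := by positivity
  linarith [piMap_add_flipAll ε]

lemma piMap_flipOn_singleton {ε : ℕ → Bool} {i : ℕ} (h : ε i = false) :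
    piMap (flipOn {i} ε) = piMap ε + gold⁻¹ ^ (i + 2) := by
  rw [← sub_eq_iff_eq_add']
  unfold piMap
  rw [← (summable_piMap _).tsum_sub (summable_piMap ε), tsum_eq_single i]
  · simp [flipOn, h]
  · intro j hj
    simp [flipOn, hj]

/-- Away from the alternating sequence, finitely many coordinates can be changed so that the
coded point moves by `β = λ⁻¹` modulo `1`. -/
lemma exists_piMap_eq_sub_or_add (m : ℕ) : ∀ ε : ℕ → Bool, ε m ≠ decide (m % 2 = 1) →
    ∃ δ : ℕ → Bool, (∃ N, ∀ i ≥ N, δ i = ε i) ∧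
      (piMap δ = piMap ε - gold⁻¹ ^ 2 ∨ piMap δ = piMap ε + gold⁻¹) := by
  have hsq := gold_inv_sq
  induction m using Nat.strong_induction_on with
  | _ m ih =>
    intro ε hm
    cases h0 : ε 0 with
    | true =>
      refine ⟨prepend false (shift ε), ⟨1, fun i hi => ?_⟩, Or.inl ?_⟩
      · obtain ⟨j, rfl⟩ := Nat.exists_eq_add_of_le' hi
        rfl
      · rw [piMap_prepend, piMap_eq_shift ε, h0]
        simp
    | false =>
      cases h1 : ε 1 with
      | false =>
        refine ⟨prepend true (prepend true (shift (shift ε))), ⟨2, fun i hi => ?_⟩, Or.inr ?_⟩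
        · obtain ⟨j, rfl⟩ := Nat.exists_eq_add_of_le' hi
          rfl
        · have h1' : shift ε 0 = false := h1
          rw [piMap_prepend, piMap_prepend, piMap_eq_shift ε, piMap_eq_shift (shift ε), h0, h1']
          simp only [if_true, Bool.false_eq_true, if_false]
          linear_combination gold⁻¹ * hsq
      | true =>
        obtain ⟨n, rfl⟩ : ∃ n, m = n + 2 := by
          rcases m with _ | _ | n
          · simp [h0] at hm
          · simp [h1] at hm
          · exact ⟨n, rfl⟩
        have h1' : shift ε 0 = true := h1
        obtain ⟨δ, ⟨N, hN⟩, hδ⟩ := ih n (by omega) (shift (shift ε)) (by simpa [shift] using hm)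
        have key (b : Bool) : ∃ M, ∀ i ≥ M, prepend b (prepend b δ) i = ε i := by
          refine ⟨N + 2, fun i hi => ?_⟩
          obtain ⟨j, rfl⟩ := Nat.exists_eq_add_of_le' (show 2 ≤ i by omega)
          exact hN j (by omega)
        rcases hδ with hδ | hδ
        · refine ⟨prepend false (prepend false δ), key _, Or.inl ?_⟩
          rw [piMap_prepend, piMap_prepend, piMap_eq_shift ε, piMap_eq_shift (shift ε), h0, h1', hδ]
          simp only [if_true, Bool.false_eq_true, if_false]
          linear_combination -gold⁻¹ ^ 2 * hsq
        · refine ⟨prepend true (prepend true δ), key _, Or.inr ?_⟩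
          rw [piMap_prepend, piMap_prepend, piMap_eq_shift ε, piMap_eq_shift (shift ε), h0, h1', hδ]
          simp only [if_true, Bool.false_eq_true, if_false]
          linear_combination gold⁻¹ * hsq

lemma fract_eq_fract_add_gold_inv {x y : ℝ} (h : y = x - gold⁻¹ ^ 2 ∨ y = x + gold⁻¹) :
    Int.fract y = Int.fract (x + gold⁻¹) := by
  rcases h with rfl | rfl
  · rw [gold_inv_sq, ← Int.fract_sub_one (x + gold⁻¹)]
    congr 1
    ring
  · rfl

namespace IsCoinMeasure

variable {p : Measure (ℕ → Bool)}

lemma ae_exists_fract_flipOn_eq (hp : IsCoinMeasure p) :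
    ∀ᵐ ε ∂p, ∃ s, Int.fract (piMap (flipOn s ε)) = Int.fract (piMap ε + gold⁻¹) := by
  filter_upwards [hp.ae_ne fun m => decide (m % 2 = 1)] with ε hε
  obtain ⟨m, hm⟩ := Function.ne_iff.1 hε
  obtain ⟨δ, ⟨N, hN⟩, hδ⟩ := exists_piMap_eq_sub_or_add m ε hm
  obtain ⟨s, rfl⟩ := exists_flipOn_eq hN
  exact ⟨s, fract_eq_fract_add_gold_inv hδ⟩

lemma ae_exists_fract_eq_flipOn (hp : IsCoinMeasure p) :
    ∀ᵐ ε ∂p, ∃ s, Int.fract (piMap ε) = Int.fract (piMap (flipOn s ε) + gold⁻¹) := by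
  filter_upwards [hp.ae_ne (flipAll fun m => decide (m % 2 = 1))] with ε hε
  obtain ⟨m, hm⟩ := Function.ne_iff.1 hε
  obtain ⟨δ, ⟨N, hN⟩, hδ⟩ := exists_piMap_eq_sub_or_add m (flipAll ε) fun h =>
    hm (by rw [flipAll, ← h]; simp [flipAll])
  obtain ⟨s, hs⟩ := exists_flipOn_eq (ε := ε) (δ := flipAll δ) (N := N) fun i hi => by
    simp [flipAll, hN i hi]
  refine ⟨s, fract_eq_fract_add_gold_inv ?_⟩
  rw [hs]
  have h1 := piMap_add_flipAll ε
  have h2 := piMap_add_flipAll δ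
  rcases hδ with hδ | hδ
  · left
    linarith
  · right
    linarith

/-- Quasi-invariance under the rotation. -/
lemma ae_fract_add_iff (hp : IsCoinMeasure p) (E : Set ℝ) :
    (∀ᵐ ε ∂p, Int.fract (piMap ε) ∉ E) ↔ ∀ᵐ ε ∂p, Int.fract (piMap ε + gold⁻¹) ∉ E := by
  constructor
  · intro h
    have h' := ae_all_iff.2 fun s => (hp.measurePreserving_flipOn s).quasiMeasurePreserving.ae h
    filter_upwards [h', hp.ae_exists_fract_flipOn_eq] with ε h1 ⟨s, hs⟩
    exact hs ▸ h1 s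
  · intro h
    have h' := ae_all_iff.2 fun s => (hp.measurePreserving_flipOn s).quasiMeasurePreserving.ae h
    filter_upwards [h', hp.ae_exists_fract_eq_flipOn] with ε h1 ⟨s, hs⟩
    exact hs ▸ h1 s

/-- Quasi-invariance under multiplication by the golden ratio. -/
lemma ae_fract_mul_iff (hp : IsCoinMeasure p) {E : Set ℝ} (hE : MeasurableSet E) :
    (∀ᵐ ε ∂p, Int.fract (piMap ε) ∉ E) ↔ ∀ᵐ ε ∂p, Int.fract (gold * piMap ε) ∉ E := by
  constructor
  · intro h
    have hs := hp.measurePreserving_shift.quasiMeasurePreserving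
    filter_upwards [hs.ae h, hs.ae ((hp.ae_fract_add_iff E).1 h)] with ε h1 h2
    rw [gold_mul_piMap]
    split_ifs
    · rwa [add_comm]
    · rwa [zero_add]
  · intro h
    have hmeas : MeasurableSet {ε | Int.fract (piMap ε) ∉ E} :=
      hE.compl.preimage (measurable_fract.comp measurable_piMap)
    rw [← hp.measurePreserving_shift.map_eq, ae_map_iff measurable_shift.aemeasurable hmeas]
    filter_upwards [h, (hp.measurePreserving_flipOn {0}).quasiMeasurePreserving.ae h] with ε h1 h2
    have hs : shift (flipOn {0} ε) = shift ε := by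
      funext i
      simp [shift, flipOn]
    rw [gold_mul_piMap] at h1 h2
    cases h0 : ε 0
    · simpa [h0] using h1
    · simpa [flipOn, h0, hs] using h2

lemma erdosOf_eq_zero_iff (hp : IsCoinMeasure p) {S : Set ℝ} (hS : MeasurableSet S)
    {P : ℝ → Prop} (h : ∀ x ∈ Set.Ico (0 : ℝ) 1, x ∈ S ↔ P x) :
    erdosOf p S = 0 ↔ ∀ᵐ ε ∂p, ¬P (piMap ε) := by
  rw [erdosOf, Measure.map_apply measurable_piMap hS, measure_eq_zero_iff_ae_notMem]
  have h' : ∀ᵐ ε ∂p, ε ∈ piMap ⁻¹' S ↔ P (piMap ε) := by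
    filter_upwards [hp.ae_ne fun _ => true] with ε hε
    exact h _ ⟨piMap_nonneg ε, piMap_lt_one hε⟩
  exact eventually_congr (h'.mono fun ε hε => not_congr hε)

end IsCoinMeasure

/-! ### Invariant sets -/

lemma mem_iff_of_fract_add_mem_iff {E : Set ℝ}
    (h : ∀ x ∈ Set.Ico (0 : ℝ) 1, x ∈ E ↔ Int.fract (x + gold⁻¹) ∈ E) (k : ℕ) :
    ∀ x : ℝ, Int.fract (x + gold⁻¹ ^ k) ∈ E ↔ Int.fract x ∈ E := by
  induction k using Nat.strong_induction_on with
  | _ k ih =>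
    intro x
    match k, ih with
    | 0, _ => simp
    | 1, _ =>
      rw [h _ ⟨Int.fract_nonneg x, Int.fract_lt_one x⟩, pow_one]
      congr! 1
      rw [Int.fract_eq_fract]
      exact ⟨⌊x⌋, by rw [Int.fract]; ring⟩
    | k + 2, ih =>
      rw [← ih (k + 1) (by omega) (x + gold⁻¹ ^ (k + 2)), ← ih k (by omega) x]
      congr! 2
      rw [pow_add, gold_inv_sq]
      ring

/-- A set invariant under `x ↦ {λ x}` is invariant under the rotation, because `x` and its
rotation have eventually equal orbits under `x ↦ {λ x}`. -/
lemma mem_iff_fract_add_of_fract_mul {E : Set ℝ}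
    (h : ∀ x ∈ Set.Ico (0 : ℝ) 1, x ∈ E ↔ Int.fract (gold * x) ∈ E) :
    ∀ x ∈ Set.Ico (0 : ℝ) 1, x ∈ E ↔ Int.fract (x + gold⁻¹) ∈ E := by
  have hβ := gold_inv_pos
  have hβ1 := gold_inv_lt_one
  have hsq := gold_inv_sq
  have hmul := gold_mul_inv
  have hg := gold_eq
  have hg1 : 1 < gold := by linarith
  have hgsq : gold * gold⁻¹ ^ 2 = gold⁻¹ := by rw [sq, ← mul_assoc, hmul, one_mul]
  have hmem {x y : ℝ} (hx : x ∈ Set.Ico (0 : ℝ) 1) (hy : y ∈ Set.Ico (0 : ℝ) 1)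
      (hxy : ∃ n : ℤ, gold * x - y = n) : x ∈ E ↔ y ∈ E := by
    rw [h x hx, Int.fract_eq_fract.2 hxy, Int.fract_eq_self.2 hy]
  have low (x : ℝ) (h0 : 0 ≤ x) (hx : x < gold⁻¹ ^ 2) : x ∈ E ↔ x + gold⁻¹ ∈ E := by
    have h1 : gold * x < gold * gold⁻¹ ^ 2 := by gcongr
    have h2 : 0 ≤ gold * x := by positivity
    rw [hmem (x := x) (y := gold * x) ⟨h0, by linarith⟩ ⟨h2, by linarith⟩ ⟨0, by simp⟩,
      hmem (x := x + gold⁻¹) (y := gold * x) ⟨by linarith, by linarith⟩ ⟨h2, by linarith⟩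
        ⟨1, by rw [mul_add, hmul]; simp⟩]
  have high (n : ℕ) : ∀ x : ℝ, gold⁻¹ ^ 2 ≤ x → x < 1 → x ≤ 1 - gold⁻¹ ^ n →
      (x ∈ E ↔ x - gold⁻¹ ^ 2 ∈ E) := by
    induction n with
    | zero =>
      intro x h1 _ h3
      have : 0 < gold⁻¹ ^ 2 := by positivity
      rw [pow_zero] at h3
      linarith
    | succ n ih =>
      intro x h1 h2 h3
      have h4 : gold⁻¹ ≤ gold * x := by rw [← hgsq]; gcongr
      rcases lt_or_ge x gold⁻¹ with hx | hx
      · have h5 : gold * x < 1 := by rw [← hmul]; gcongr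
        rw [hmem (x := x) (y := gold * x) ⟨by linarith, h2⟩ ⟨by linarith, h5⟩ ⟨0, by simp⟩,
          hmem (x := x - gold⁻¹ ^ 2) (y := gold * x - gold⁻¹) ⟨by linarith, by linarith⟩
            ⟨by linarith, by linarith⟩ ⟨0, by rw [mul_sub, hgsq]; simp⟩,
          low (gold * x - gold⁻¹) (by linarith) (by linarith), sub_add_cancel]
      · have h5 : 1 ≤ gold * x := by rw [← hmul]; gcongr
        have h6 : gold * x < gold := mul_lt_of_lt_one_right (by linarith) h2
        have h7 : gold * x ≤ gold - gold⁻¹ ^ n := by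
          calc gold * x ≤ gold * (1 - gold⁻¹ ^ (n + 1)) := by gcongr
            _ = _ := by rw [mul_sub, pow_succ', ← mul_assoc, hmul]; ring
        rw [hmem (x := x) (y := gold * x - gold⁻¹ - gold⁻¹ ^ 2) ⟨by linarith, h2⟩
            ⟨by linarith, by linarith⟩ ⟨1, by rw [hsq]; push_cast; ring⟩,
          hmem (x := x - gold⁻¹ ^ 2) (y := gold * x - gold⁻¹) ⟨by linarith, by linarith⟩
            ⟨by linarith, by linarith⟩ ⟨0, by rw [mul_sub, hgsq]; simp⟩,
          ih (gold * x - gold⁻¹) (by linarith) (by linarith) (by linarith)]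
  intro x hx
  rcases lt_or_ge x (gold⁻¹ ^ 2) with h1 | h1
  · rw [low x hx.1 h1, Int.fract_eq_self.2 ⟨by linarith [hx.1], by linarith⟩]
  · obtain ⟨n, hn⟩ := exists_pow_lt_of_lt_one (sub_pos.2 hx.2) hβ1
    rw [← fract_eq_fract_add_gold_inv (Or.inl rfl),
      Int.fract_eq_self.2 ⟨by linarith, by linarith [hx.2, pow_pos hβ 2]⟩]
    exact high n x h1 hx.2 (by linarith)

/-- Ergodicity of the rotation. -/
lemma erdosOf_zero_or_one {p : Measure (ℕ → Bool)} (hp : IsCoinMeasure p) {E : Set ℝ}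
    (hE : MeasurableSet E)
    (h : ∀ x ∈ Set.Ico (0 : ℝ) 1, x ∈ E ↔ Int.fract (x + gold⁻¹) ∈ E) :
    erdosOf p E = 0 ∨ erdosOf p E = 1 := by
  have hmeas : MeasurableSet {ε | Int.fract (piMap ε) ∈ E} :=
    hE.preimage (measurable_fract.comp measurable_piMap)
  have heq : erdosOf p E = p {ε | Int.fract (piMap ε) ∈ E} := by
    rw [erdosOf, Measure.map_apply measurable_piMap hE]
    refine measure_congr ?_
    filter_upwards [hp.ae_ne fun _ => true] with ε hε
    refine propext ?_
    change piMap ε ∈ E ↔ Int.fract (piMap ε) ∈ E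
    rw [Int.fract_eq_self.2 ⟨piMap_nonneg ε, piMap_lt_one hε⟩]
  rw [heq]
  refine hp.zero_or_one hmeas fun i ε => ?_
  change Int.fract (piMap (flipOn {i} ε)) ∈ E ↔ Int.fract (piMap ε) ∈ E
  cases hi : ε i with
  | false => rw [piMap_flipOn_singleton hi, mem_iff_of_fract_add_mem_iff h]
  | true =>
    have hf : flipOn {i} ε i = false := by simp [flipOn, hi]
    rw [← mem_iff_of_fract_add_mem_iff h (i + 2), ← piMap_flipOn_singleton hf, flipOn_flipOn]

/-- The Erdős measure is quasi-invariant and ergodic with respect to both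
`T x = {λ x}` and the rotation `R x = x + λ⁻¹ (mod 1)` of `[0,1)`. -/
theorem erdos_quasiInvariant_ergodic (p : Measure (ℕ → Bool)) (hp : IsCoinMeasure p) :
    (∀ E : Set ℝ, MeasurableSet E → E ⊆ Set.Ico 0 1 →
      (erdosOf p E = 0 ↔
        erdosOf p {x | x ∈ Set.Ico (0 : ℝ) 1 ∧ Int.fract (gold * x) ∈ E} = 0) ∧
      (erdosOf p E = 0 ↔
        erdosOf p {x | x ∈ Set.Ico (0 : ℝ) 1 ∧ Int.fract (x + gold⁻¹) ∈ E} = 0)) ∧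
    (∀ E : Set ℝ, MeasurableSet E → E ⊆ Set.Ico 0 1 →
      {x | x ∈ Set.Ico (0 : ℝ) 1 ∧ Int.fract (gold * x) ∈ E} = E →
        erdosOf p E = 0 ∨ erdosOf p E = 1) ∧
    (∀ E : Set ℝ, MeasurableSet E → E ⊆ Set.Ico 0 1 →
      {x | x ∈ Set.Ico (0 : ℝ) 1 ∧ Int.fract (x + gold⁻¹) ∈ E} = E →
        erdosOf p E = 0 ∨ erdosOf p E = 1) := by
  have hT : Measurable fun x : ℝ => Int.fract (gold * x) :=
    measurable_fract.comp (measurable_const_mul gold)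
  have hR : Measurable fun x : ℝ => Int.fract (x + gold⁻¹) :=
    measurable_fract.comp (measurable_add_const gold⁻¹)
  refine ⟨fun E hE _ => ?_, fun E hE _ h => ?_, fun E hE _ h => ?_⟩
  · have h0 := hp.erdosOf_eq_zero_iff hE (P := fun x => Int.fract x ∈ E) fun x hx => by
      rw [Int.fract_eq_self.2 hx]
    refine ⟨h0.trans ((hp.ae_fract_mul_iff hE).trans ?_),
      h0.trans ((hp.ae_fract_add_iff E).trans ?_)⟩
    · exact (hp.erdosOf_eq_zero_iff (measurableSet_Ico.inter (hT hE))
        (P := fun x => Int.fract (gold * x) ∈ E) fun x hx => and_iff_right hx).symm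
    · exact (hp.erdosOf_eq_zero_iff (measurableSet_Ico.inter (hR hE))
        (P := fun x => Int.fract (x + gold⁻¹) ∈ E) fun x hx => and_iff_right hx).symm
  · exact erdosOf_zero_or_one hp hE (mem_iff_fract_add_of_fract_mul fun x hx =>
      (Set.ext_iff.1 h x).symm.trans (and_iff_right hx))
  · exact erdosOf_zero_or_one hp hE fun x hx =>
      (Set.ext_iff.1 h x).symm.trans (and_iff_right hx)
end

section
/- (Erdős theorem) The Erdős measure μ is singular with respect to Lebesgue measure on [0,1]. -/
open MeasureTheory Filter Topology
open scoped ENNReal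

namespace ErdosMeasure

lemma gold_eq : gold = Real.goldenRatio := rfl

lemma one_lt_gold : 1 < gold := Real.one_lt_goldenRatio

lemma gold_pos : 0 < gold := Real.goldenRatio_pos

lemma gold_sq : gold ^ 2 = gold + 1 := Real.goldenRatio_sq

/-! ### Cosines at powers of the golden ratio -/

lemma exists_int_eq_gold_pow_add (n : ℕ) :
    ∃ k : ℤ, gold ^ n + (-gold⁻¹) ^ n = k := by
  have hψ : (-gold⁻¹) = Real.goldenConj := by
    rw [gold_eq, Real.inv_goldenRatio, neg_neg]
  rw [hψ, gold_eq]
  induction n using Nat.twoStepInduction with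
  | zero => exact ⟨2, by norm_num⟩
  | one => exact ⟨1, by simp⟩
  | more n h₀ h₁ =>
    obtain ⟨a, ha⟩ := h₀
    obtain ⟨b, hb⟩ := h₁
    refine ⟨a + b, ?_⟩
    push_cast
    rw [← ha, ← hb, pow_add, pow_add _ n 2, Real.goldenRatio_sq, Real.goldenConj_sq]
    ring

lemma abs_cos_pi_mul_gold_pow (n : ℕ) :
    |Real.cos (Real.pi * gold ^ n)| = |Real.cos (Real.pi * (gold⁻¹) ^ n)| := by
  obtain ⟨k, hk⟩ := exists_int_eq_gold_pow_add n
  have h₁ : Real.pi * gold ^ n = k * Real.pi - Real.pi * (-gold⁻¹) ^ n := by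
    rw [← hk]; ring
  rw [h₁, Real.cos_int_mul_pi_sub, abs_mul, abs_zpow, abs_neg, abs_one, one_zpow, one_mul]
  rcases Nat.even_or_odd n with h | h
  · rw [h.neg_pow]
  · rw [h.neg_pow, mul_neg, Real.cos_neg]

lemma cos_pi_mul_inv_gold_pow_ne_zero (n : ℕ) : Real.cos (Real.pi * (gold⁻¹) ^ n) ≠ 0 := by
  intro h
  have hg := gold_pos
  have h1 : (gold⁻¹) ^ n ≤ 1 := pow_le_one₀ (by positivity) (inv_le_one_of_one_le₀ one_lt_gold.le)
  have hpi := Real.pi_pos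
  have heq : Real.pi * (gold⁻¹) ^ n = Real.pi / 2 := by
    refine Real.injOn_cos ⟨by positivity, by nlinarith⟩ ⟨by positivity, by linarith⟩ ?_
    rw [h, Real.cos_pi_div_two]
  have h2 : gold ^ n = 2 := by
    rw [inv_pow] at heq
    field_simp at heq
    linarith
  match n with
  | 0 => norm_num at h2
  | 1 => rw [pow_one, gold_eq] at h2; exact Real.goldenRatio_lt_two.ne h2
  | m + 2 =>
    have : 1 ≤ gold ^ m := one_le_pow₀ one_lt_gold.le
    rw [pow_add, gold_sq] at h2
    nlinarith [one_lt_gold]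

lemma cos_pi_mul_gold_zpow_ne_zero (k : ℤ) : Real.cos (Real.pi * gold ^ k) ≠ 0 := by
  obtain ⟨n, rfl | rfl⟩ := k.eq_nat_or_neg
  · rw [← abs_pos, zpow_natCast, abs_cos_pi_mul_gold_pow, abs_pos]
    exact cos_pi_mul_inv_gold_pow_ne_zero n
  · rw [zpow_neg, zpow_natCast, ← inv_pow]
    exact cos_pi_mul_inv_gold_pow_ne_zero n

/-- The partial products of `cos (π λ^{-k})` converge to a nonzero limit. -/
lemma exists_tendsto_prod_cos :
    ∃ c : ℝ, c ≠ 0 ∧ Tendsto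
      (fun n ↦ ∏ k ∈ Finset.range n, Real.cos (Real.pi * (gold⁻¹) ^ k)) atTop (𝓝 c) := by
  set f : ℕ → ℝ := fun k ↦ Real.cos (Real.pi * (gold⁻¹) ^ k) - 1
  have hf : ∀ k, 1 + f k = Real.cos (Real.pi * (gold⁻¹) ^ k) := fun k ↦ by simp [f]
  have hg := gold_pos
  have hs : Summable (fun k ↦ ‖f k‖) := by
    have hr : Summable (fun k : ℕ ↦ Real.pi ^ 2 / 2 * (gold⁻¹ ^ 2) ^ k) :=
      (summable_geometric_of_lt_one (by positivity)
        (pow_lt_one₀ (by positivity) (inv_lt_one_of_one_lt₀ one_lt_gold) two_ne_zero)).mul_left _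
    refine hr.of_nonneg_of_le (fun _ ↦ norm_nonneg _) fun k ↦ ?_
    have h₁ := Real.cos_le_one (Real.pi * (gold⁻¹) ^ k)
    have h₂ := Real.one_sub_sq_div_two_le_cos (x := Real.pi * (gold⁻¹) ^ k)
    rw [Real.norm_eq_abs, abs_le]
    have h₃ : Real.pi ^ 2 / 2 * (gold⁻¹ ^ 2) ^ k = (Real.pi * (gold⁻¹) ^ k) ^ 2 / 2 := by
      rw [← pow_mul, mul_pow, ← pow_mul, mul_comm k 2]; ring
    rw [h₃]
    have := sq_nonneg (Real.pi * (gold⁻¹) ^ k)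
    constructor <;> simp only [f] <;> linarith
  refine ⟨∏' k, (1 + f k), tprod_one_add_ne_zero_of_summable (fun k ↦ ?_) hs, ?_⟩
  · rw [hf]; exact cos_pi_mul_inv_gold_pow_ne_zero k
  · simpa only [hf] using (multipliable_one_add_of_summable hs).hasProd.tendsto_prod_nat

/-! ### The self-similarity operator -/

/-- The two contractions `x ↦ λ⁻¹ x + i λ⁻²`, `i ∈ {0, 1}`. -/
noncomputable def contr (b : Bool) (x : ℝ) : ℝ := gold⁻¹ * x + if b then gold⁻¹ ^ 2 else 0

/-- The self-similarity operator whose fixed probability measure is the Erdős measure. -/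
noncomputable def selfSim (ν : Measure ℝ) : Measure ℝ :=
  (2 : ℝ≥0∞)⁻¹ • (ν.map (contr false) + ν.map (contr true))

@[fun_prop]
lemma measurable_contr (b : Bool) : Measurable (contr b) := by
  unfold contr; fun_prop

lemma map_affine_volume_absolutelyContinuous {a : ℝ} (ha : a ≠ 0) (c : ℝ) :
    (volume : Measure ℝ).map (fun x ↦ a * x + c) ≪ volume := by
  have : (volume : Measure ℝ).map (fun x ↦ a * x + c)
      = ((volume : Measure ℝ).map (a * ·)).map (· + c) := by
    rw [Measure.map_map (by fun_prop) (by fun_prop)]; rfl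
  rw [this, Real.map_volume_mul_left ha, Measure.map_smul, map_add_right_eq_self]
  exact Measure.smul_absolutelyContinuous

lemma absolutelyContinuous_map_contr {ν : Measure ℝ} (h : ν ≪ volume) (b : Bool) :
    ν.map (contr b) ≪ volume :=
  (h.map (measurable_contr b)).trans
    (map_affine_volume_absolutelyContinuous (inv_ne_zero gold_pos.ne') _)

lemma mutuallySingular_map_contr {ν : Measure ℝ} (h : ν ⟂ₘ volume) (b : Bool) :
    ν.map (contr b) ⟂ₘ volume := by
  obtain ⟨E, hE, h₀, h₁⟩ := h
  set d : ℝ := if b then gold⁻¹ ^ 2 else 0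
  set R : ℝ → ℝ := fun x ↦ gold * x + -(gold * d)
  have hR : Measurable R := by fun_prop
  have hRS : ∀ x, R (contr b x) = x := fun x ↦ by
    have := gold_pos.ne'
    simp only [R, contr, d]
    field_simp
    ring
  refine ⟨R ⁻¹' E, hR hE, ?_, ?_⟩
  · rw [Measure.map_apply (measurable_contr b) (hR hE)]
    convert h₀ using 2
    ext x
    simp [hRS]
  · rw [← Set.preimage_compl, ← Measure.map_apply hR hE.compl]
    exact map_affine_volume_absolutelyContinuous gold_pos.ne' _ h₁

lemma selfSim_add (ν ρ : Measure ℝ) : selfSim (ν + ρ) = selfSim ν + selfSim ρ := by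
  simp only [selfSim, Measure.map_add _ _ (measurable_contr _), ← smul_add]
  congr 1
  abel

lemma selfSim_absolutelyContinuous {ν : Measure ℝ} (h : ν ≪ volume) : selfSim ν ≪ volume :=
  Measure.smul_absolutelyContinuous.trans
    (Measure.AbsolutelyContinuous.add_left (absolutelyContinuous_map_contr h _)
      (absolutelyContinuous_map_contr h _))

lemma selfSim_mutuallySingular {ν : Measure ℝ} (h : ν ⟂ₘ volume) : selfSim ν ⟂ₘ volume :=
  (Measure.MutuallySingular.add_left (mutuallySingular_map_contr h _)
    (mutuallySingular_map_contr h _)).smul _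

instance (ν : Measure ℝ) [IsFiniteMeasure ν] : IsFiniteMeasure (selfSim ν) := by
  unfold selfSim
  exact Measure.smul_finite _ (by simp)

/-- The absolutely continuous part of a fixed point of `selfSim` is a fixed point. -/
lemma selfSim_withDensity_rnDeriv {μ : Measure ℝ} [IsFiniteMeasure μ] (h : selfSim μ = μ) :
    selfSim (volume.withDensity (μ.rnDeriv volume)) = volume.withDensity (μ.rnDeriv volume) := by
  set ν := volume.withDensity (μ.rnDeriv volume)
  have hν : selfSim ν ≪ volume :=
    selfSim_absolutelyContinuous (withDensity_absolutelyContinuous _ _)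
  have hdec : μ = selfSim (μ.singularPart volume) + selfSim ν := by
    rw [← selfSim_add, Measure.singularPart_add_rnDeriv, h]
  have hfin : IsFiniteMeasure ν := by
    unfold ν; infer_instance
  rw [← Measure.withDensity_rnDeriv_eq _ _ hν] at hdec ⊢
  exact Measure.eq_withDensity_rnDeriv (Measure.measurable_rnDeriv _ _)
    (selfSim_mutuallySingular (μ.mutuallySingular_singularPart volume)) hdec

/-! ### Characteristic functions -/

lemma charFun_map_contr (ν : Measure ℝ) (b : Bool) (t : ℝ) :
    charFun (ν.map (contr b)) t = charFun ν (gold⁻¹ * t) *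
      Complex.exp (((if b then gold⁻¹ ^ 2 else 0 : ℝ) * t : ℝ) * Complex.I) := by
  have : ν.map (contr b)
      = (ν.map (gold⁻¹ * ·)).map (· + (if b then gold⁻¹ ^ 2 else 0 : ℝ)) := by
    rw [Measure.map_map (by fun_prop) (by fun_prop)]; rfl
  rw [this, charFun_map_add_const, charFun_map_mul]
  simp only [RCLike.inner_apply, conj_trivial]
  congr 4
  ring

lemma norm_one_add_exp (θ : ℝ) :
    ‖1 + Complex.exp (θ * Complex.I)‖ = 2 * |Real.cos (θ / 2)| := by
  have : 1 + Complex.exp (θ * Complex.I)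
      = Complex.exp ((θ / 2 : ℝ) * Complex.I) * ((2 * Real.cos (θ / 2) : ℝ) : ℂ) := by
    push_cast
    rw [Complex.two_cos, mul_add, ← Complex.exp_add, ← Complex.exp_add, add_comm]
    congr 1
    · congr 1; ring
    · rw [← Complex.exp_zero]; congr 1; ring
  rw [this, norm_mul, Complex.norm_exp_ofReal_mul_I, one_mul, Complex.norm_real, norm_mul]
  simp

lemma norm_charFun_selfSim (ν : Measure ℝ) [IsFiniteMeasure ν] (t : ℝ) :
    ‖charFun (selfSim ν) t‖ = |Real.cos (gold⁻¹ ^ 2 * t / 2)| * ‖charFun ν (gold⁻¹ * t)‖ := by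
  have hint : ∀ b, Integrable (fun x : ℝ ↦ Complex.exp (t * x * Complex.I))
      (ν.map (contr b)) := fun b ↦ by
    refine Integrable.of_bound (by fun_prop) 1 (.of_forall fun x ↦ ?_)
    rw [← Complex.ofReal_mul, Complex.norm_exp_ofReal_mul_I]
  have : charFun (selfSim ν) t
      = 2⁻¹ * (charFun (ν.map (contr false)) t + charFun (ν.map (contr true)) t) := by
    simp only [charFun_apply_real, selfSim]
    rw [integral_smul_measure, integral_add_measure (hint _) (hint _)]
    simp [mul_add]
  rw [this, charFun_map_contr, charFun_map_contr, ← mul_add]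
  simp only [Bool.false_eq_true, if_false, if_true, zero_mul, Complex.ofReal_zero,
    Complex.exp_zero]
  rw [norm_mul, norm_mul, norm_one_add_exp, norm_inv, Complex.norm_ofNat]
  ring

lemma tendsto_charFun_cocompact {ν : Measure ℝ} [IsFiniteMeasure ν] (h : ν ≪ volume) :
    Tendsto (charFun ν) (cocompact ℝ) (𝓝 0) := by
  have h₁ := (Real.tendsto_integral_exp_smul_cocompact
    (fun x ↦ (((ν.rnDeriv volume x).toReal : ℝ) : ℂ))).comp
    (Homeomorph.mulLeft₀ (-(2 * Real.pi)⁻¹)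
      (neg_ne_zero.2 (inv_ne_zero Real.two_pi_pos.ne'))).isClosedEmbedding.tendsto_cocompact
  refine h₁.congr fun t ↦ ?_
  rw [charFun_apply_real, ← integral_rnDeriv_smul h]
  refine integral_congr_ae (.of_forall fun x ↦ ?_)
  have hpi := Real.pi_pos.ne'
  simp only [Homeomorph.coe_mulLeft₀, Circle.smul_def, smul_eq_mul, Complex.real_smul,
    Real.fourierChar_apply]
  rw [mul_comm, ← Complex.ofReal_mul t x]
  congr 4
  field_simp

/-- An absolutely continuous finite fixed point of `selfSim` vanishes. -/
lemma eq_zero_of_selfSim_eq {ν : Measure ℝ} [IsFiniteMeasure ν] (hac : ν ≪ volume)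
    (h : selfSim ν = ν) : ν = 0 := by
  have hg := gold_pos
  set u : ℤ → ℝ := fun k ↦ ‖charFun ν (2 * Real.pi * gold ^ (k + 1))‖
  have hu : ∀ k, u (k + 1) = |Real.cos (Real.pi * gold ^ k)| * u k := fun k ↦ by
    have h₁ : gold⁻¹ ^ 2 * (2 * Real.pi * gold ^ (k + 1 + 1)) / 2 = Real.pi * gold ^ k := by
      rw [zpow_add_one₀ hg.ne', zpow_add_one₀ hg.ne']; field_simp
    have h₂ : gold⁻¹ * (2 * Real.pi * gold ^ (k + 1 + 1)) = 2 * Real.pi * gold ^ (k + 1) := by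
      rw [zpow_add_one₀ hg.ne' (k + 1)]; field_simp
    have h₃ := norm_charFun_selfSim ν (2 * Real.pi * gold ^ (k + 1 + 1))
    rwa [h, h₁, h₂] at h₃
  have hprod : ∀ n : ℕ,
      u n = |∏ k ∈ Finset.range n, Real.cos (Real.pi * (gold⁻¹) ^ k)| * u 0 := fun n ↦ by
    induction n with
    | zero => simp
    | succ n ih =>
      rw [Nat.cast_succ, hu, ih, Finset.prod_range_succ, abs_mul, zpow_natCast,
        abs_cos_pi_mul_gold_pow]
      ring
  have hlim : Tendsto (fun n : ℕ ↦ u n) atTop (𝓝 0) := by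
    have h₁ : Tendsto (fun n : ℕ ↦ 2 * Real.pi * gold ^ (n + 1)) atTop atTop :=
      ((tendsto_pow_atTop_atTop_of_one_lt one_lt_gold).comp
        (tendsto_add_atTop_nat 1)).const_mul_atTop Real.two_pi_pos
    have h₂ := ((tendsto_charFun_cocompact hac).comp
      (h₁.mono_right atTop_le_cocompact)).norm
    rw [norm_zero] at h₂
    refine h₂.congr fun n ↦ ?_
    simp only [u, Function.comp_apply]
    norm_cast
  have hu0 : u 0 = 0 := by
    obtain ⟨c, hc, hcl⟩ := exists_tendsto_prod_cos
    have := tendsto_nhds_unique hlim ((hcl.abs.mul_const (u 0)).congr fun n ↦ (hprod n).symm)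
    simpa [hc] using this.symm
  have huneg : ∀ n : ℕ, u (-n) = 0 := fun n ↦ by
    induction n with
    | zero => simpa using hu0
    | succ n ih =>
      have h₁ := hu (-(n + 1 : ℕ))
      rw [show (-((n + 1 : ℕ) : ℤ) + 1) = -n by push_cast; ring, ih] at h₁
      simpa [cos_pi_mul_gold_zpow_ne_zero] using h₁.symm
  have hlim0 : Tendsto (fun n : ℕ ↦ u (-n)) atTop (𝓝 ‖charFun ν 0‖) := by
    have h₁ : Tendsto (fun n : ℕ ↦ 2 * Real.pi * gold * gold⁻¹ ^ n) atTop (𝓝 0) := by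
      simpa using (tendsto_pow_atTop_nhds_zero_of_lt_one (inv_nonneg.2 hg.le)
        (inv_lt_one_of_one_lt₀ one_lt_gold)).const_mul (2 * Real.pi * gold)
    refine (((continuous_charFun (μ := ν)).tendsto 0).comp h₁).norm.congr fun n ↦ ?_
    simp only [u, Function.comp_apply]
    rw [zpow_add_one₀ hg.ne', zpow_neg, zpow_natCast, inv_pow]
    congr 2
    ring
  have h0 : ‖charFun ν 0‖ = 0 :=
    tendsto_nhds_unique hlim0 (tendsto_const_nhds.congr fun n ↦ (huneg n).symm)
  simpa [charFun_zero, measureReal_def, ENNReal.toReal_eq_zero_iff] using h0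

/-! ### Coin measures -/

/-- The set of sequences that agree with `b` in the first `n` places. -/
def initCyl (n : ℕ) (b : ℕ → Bool) : Set (ℕ → Bool) := {ε | ∀ i ∈ Finset.range n, ε i = b i}

lemma measurableSet_initCyl (n : ℕ) (b : ℕ → Bool) : MeasurableSet (initCyl n b) := by
  have : initCyl n b = ⋂ i ∈ Finset.range n, (fun ε : ℕ → Bool ↦ ε i) ⁻¹' {b i} := by
    ext ε; simp [initCyl]
  rw [this]
  exact Finset.measurableSet_biInter _ fun i _ ↦ measurable_pi_apply i (measurableSet_singleton _)

lemma isPiSystem_initCyl : IsPiSystem {S | ∃ n b, S = initCyl n b} := by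
  rintro _ ⟨n, b, rfl⟩ _ ⟨m, c, rfl⟩ ⟨ε, hn, hm⟩
  refine ⟨max n m, ε, ?_⟩
  ext δ
  simp only [initCyl, Finset.mem_range, Set.mem_ofPred_eq, Set.mem_inter_iff, lt_max_iff] at hn hm ⊢
  constructor
  · rintro ⟨h₁, h₂⟩ i (hi | hi)
    · rw [h₁ i hi, hn i hi]
    · rw [h₂ i hi, hm i hi]
  · intro h
    exact ⟨fun i hi ↦ (h i (.inl hi)).trans (hn i hi), fun i hi ↦ (h i (.inr hi)).trans (hm i hi)⟩

lemma generateFrom_initCyl :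
    (MeasurableSpace.pi : MeasurableSpace (ℕ → Bool))
      = MeasurableSpace.generateFrom {S | ∃ n b, S = initCyl n b} := by
  refine le_antisymm (iSup_le fun i ↦ ?_) (MeasurableSpace.generateFrom_le ?_)
  · rw [← measurable_iff_comap_le]
    refine @measurable_to_bool _ (MeasurableSpace.generateFrom _) _ ?_
    have : (fun ε : ℕ → Bool ↦ ε i) ⁻¹' {true} = ⋃ (f : Fin (i + 1) → Bool),
        ⋃ (_ : f (Fin.last i) = true),
          initCyl (i + 1) (fun j ↦ if h : j < i + 1 then f ⟨j, h⟩ else false) := by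
      ext ε
      simp only [Set.mem_preimage, Set.mem_singleton_iff, Set.mem_iUnion, initCyl,
        Set.mem_ofPred_eq, Finset.mem_range]
      constructor
      · intro h
        exact ⟨fun j ↦ ε j, h, fun j hj ↦ by simp [hj]⟩
      · rintro ⟨f, hf, h⟩
        rw [h i i.lt_succ_self, dif_pos i.lt_succ_self]
        exact hf
    rw [this]
    exact MeasurableSet.iUnion fun f ↦ MeasurableSet.iUnion fun _ ↦
      MeasurableSpace.measurableSet_generateFrom ⟨_, _, rfl⟩
  · rintro _ ⟨n, b, rfl⟩
    exact measurableSet_initCyl n b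

/-- Prepend a digit to a sequence of digits. -/
def consSeq (c : Bool) (ε : ℕ → Bool) : ℕ → Bool
  | 0 => c
  | n + 1 => ε n

@[fun_prop]
lemma measurable_consSeq (c : Bool) : Measurable (consSeq c) := by
  refine measurable_pi_lambda _ fun i ↦ ?_
  cases i with
  | zero => exact measurable_const
  | succ n => exact measurable_pi_apply n

lemma consSeq_preimage_initCyl (c : Bool) (n : ℕ) (b : ℕ → Bool) :
    consSeq c ⁻¹' initCyl (n + 1) b = if c = b 0 then initCyl n (fun i ↦ b (i + 1)) else ∅ := by
  ext ε
  simp only [initCyl, Finset.mem_range, Set.mem_preimage, Set.mem_ofPred_eq,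
    Nat.forall_lt_succ_left]
  split_ifs with h <;> simp [consSeq, h]

lemma isProbabilityMeasure {p : Measure (ℕ → Bool)} (hp : IsCoinMeasure p) :
    IsProbabilityMeasure p :=
  ⟨by simpa using hp ∅ fun _ ↦ false⟩

lemma coin_initCyl {p : Measure (ℕ → Bool)} (hp : IsCoinMeasure p) (n : ℕ)
    (b : ℕ → Bool) : p (initCyl n b) = (2 : ℝ≥0∞)⁻¹ ^ n := by
  simpa only [initCyl, Finset.card_range] using hp (Finset.range n) b

lemma coin_eq_map_consSeq {p : Measure (ℕ → Bool)} (hp : IsCoinMeasure p) :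
    p = (2 : ℝ≥0∞)⁻¹ • (p.map (consSeq false) + p.map (consSeq true)) := by
  have := isProbabilityMeasure hp
  have huniv : p Set.univ
      = ((2 : ℝ≥0∞)⁻¹ • (p.map (consSeq false) + p.map (consSeq true))) Set.univ := by
    simp only [Measure.smul_apply, Measure.add_apply, smul_eq_mul,
      Measure.map_apply (measurable_consSeq _) MeasurableSet.univ, Set.preimage_univ,
      measure_univ]
    rw [one_add_one_eq_two, ENNReal.inv_mul_cancel two_ne_zero ENNReal.ofNat_ne_top]
  refine ext_of_generate_finite _ generateFrom_initCyl isPiSystem_initCyl ?_ huniv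
  rintro _ ⟨n, b, rfl⟩
  cases n with
  | zero =>
    have : initCyl 0 b = Set.univ := by ext; simp [initCyl]
    rw [this, huniv]
  | succ n =>
    simp only [Measure.smul_apply, Measure.add_apply, smul_eq_mul,
      Measure.map_apply (measurable_consSeq _) (measurableSet_initCyl _ _),
      consSeq_preimage_initCyl]
    rw [coin_initCyl hp, pow_succ']
    cases b 0 <;> simp [coin_initCyl hp]

/-! ### The Erdős measure -/

lemma summable_gold : Summable (fun k : ℕ ↦ gold⁻¹ ^ (k + 2)) :=
  (summable_nat_add_iff 2).2 (summable_geometric_of_lt_one (inv_nonneg.2 gold_pos.le)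
    (inv_lt_one_of_one_lt₀ one_lt_gold))

lemma norm_digit_le (c : Bool) (k : ℕ) :
    ‖(if c then gold⁻¹ ^ (k + 2) else 0 : ℝ)‖ ≤ gold⁻¹ ^ (k + 2) := by
  have : 0 ≤ gold⁻¹ ^ (k + 2) := pow_nonneg (inv_nonneg.2 gold_pos.le) _
  cases c
  · simpa using this
  · simp [abs_of_nonneg gold_pos.le]

lemma measurable_piMap : Measurable piMap := by
  refine (continuous_tsum (fun k ↦ ?_) summable_gold
    fun k (ε : ℕ → Bool) ↦ norm_digit_le (ε k) k).measurable
  exact (continuous_of_discreteTopology (f := fun c : Bool ↦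
    (if c then gold⁻¹ ^ (k + 2) else 0 : ℝ))).comp (continuous_apply k)

lemma piMap_consSeq (c : Bool) (ε : ℕ → Bool) : piMap (consSeq c ε) = contr c (piMap ε) := by
  have hs : Summable (fun k ↦ if consSeq c ε k then gold⁻¹ ^ (k + 2) else 0) :=
    summable_gold.of_norm_bounded fun k ↦ norm_digit_le _ k
  unfold piMap contr
  rw [hs.tsum_eq_zero_add, add_comm, ← tsum_mul_left]
  congr 1
  refine tsum_congr fun k ↦ ?_
  simp only [consSeq, mul_ite, mul_zero]
  congr 1
  ring

lemma selfSim_erdosOf {p : Measure (ℕ → Bool)} (hp : IsCoinMeasure p) :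
    selfSim (erdosOf p) = erdosOf p := by
  have hmap : ∀ c, (erdosOf p).map (contr c) = (p.map (consSeq c)).map piMap := fun c ↦ by
    rw [erdosOf, Measure.map_map (measurable_contr c) measurable_piMap,
      Measure.map_map measurable_piMap (measurable_consSeq c)]
    congr 1
    ext ε
    exact (piMap_consSeq c ε).symm
  rw [selfSim, hmap, hmap, ← Measure.map_add _ _ measurable_piMap, ← Measure.map_smul,
    ← coin_eq_map_consSeq hp, erdosOf]

end ErdosMeasure

/-- Erdős theorem: the Erdős measure is singular with respect to Lebesgue measure
on `[0,1]`. -/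
theorem erdos_singular (p : Measure (ℕ → Bool)) (hp : IsCoinMeasure p) :
    (erdosOf p).MutuallySingular (volume.restrict (Set.Icc (0 : ℝ) 1)) := by
  have := ErdosMeasure.isProbabilityMeasure hp
  have : IsFiniteMeasure (erdosOf p) := by unfold erdosOf; infer_instance
  have hzero := ErdosMeasure.eq_zero_of_selfSim_eq (withDensity_absolutelyContinuous _ _)
    (ErdosMeasure.selfSim_withDensity_rnDeriv (ErdosMeasure.selfSim_erdosOf hp))
  have hdec := (erdosOf p).singularPart_add_rnDeriv volume
  rw [hzero, add_zero] at hdec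
  rw [← hdec]
  exact ((erdosOf p).mutuallySingular_singularPart volume).mono_ac .rfl
    Measure.restrict_le_self.absolutelyContinuous
end

section
/- (Alexander–Zagier formula) The limit H_μ = lim_{n→∞} H^{(n)}/n exists and equals Λ − (1/18)·Σ_{n=1}^∞ k_n·4^{−n}, where H^{(n)} = −Σ_{k=0}^{F_{n+2}−2} (f_n(k)/2^n)·log_λ(f_n(k)/2^n). -/
/-- The value Σ_{j=1}^ℓ w_j λ^{-j} of a 0-1 word `(w_1, …, w_ℓ)`. -/
noncomputable def wordVal : List Bool → ℝ
  | [] => 0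
  | b :: t => ((if b then 1 else 0) + wordVal t) / gold

/-- `wordF w` is the number of 0-1 words of the same length as `w` having the same
value as `w`. -/
noncomputable def wordF (w : List Bool) : ℕ :=
  Nat.card {v : List Bool // v.length = w.length ∧ wordVal v = wordVal w}

/-- The block `B(a_1, …, a_t)`: the 0-1 word `1(00)^{a_1}(01)^{a_2}⋯(00)^{a_t}` if `t`
is odd and `1(01)^{a_1}(00)^{a_2}⋯(00)^{a_t}` if `t` is even (`1 = true`, `0 = false`);
the `i`-th group is `(00)^{a_i}` when `i ≡ t (mod 2)` and `(01)^{a_i}` otherwise. -/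
def blockWord (a : List ℕ) : List Bool :=
  true :: (((List.range a.length).map fun i =>
    (List.replicate (a.getD i 0)
      (if (a.length - 1 - i) % 2 = 0 then [false, false] else [false, true])).flatten).flatten)

/-- The finite continued fraction `[a_1, …, a_t] = 1/(a_1 + 1/(a_2 + ⋯ + 1/a_t))`. -/
def cf : List ℕ → ℚ
  | [] => 0
  | a :: t => 1 / ((a : ℚ) + cf t)

/-- `p + q` where `p/q = [a_1, …, a_t]` in lowest terms. -/
def pqSum (a : List ℕ) : ℕ := (cf a).num.toNat + (cf a).den

/-- `k_n = Σ over compositions (a_1,…,a_t) of n of (p+q)·log_λ(p+q)`,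
where `p/q = [a_1,…,a_t]` in lowest terms. -/
noncomputable def kcoef (n : ℕ) : ℝ :=
  ∑' a : {l : List ℕ // l.sum = n ∧ ∀ x ∈ l, 0 < x},
    (pqSum a.1 : ℝ) * Real.logb gold (pqSum a.1)

/-- Fibonacci numbers with the convention `F 1 = 1`, `F 2 = 2`. -/
def fibF (n : ℕ) : ℕ := Nat.fib (n + 1)

/-- `countRep n k` is the number of tuples `(ε_1,…,ε_n) ∈ {0,1}^n` with
`k = Σ_{j=1}^n ε_j F_j`. -/
def countRep (n k : ℕ) : ℕ :=
  (Finset.univ.filter fun ε : Fin n → Bool =>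
    (∑ j : Fin n, if ε j then fibF (j + 1) else 0) = k).card

/-- `H⁽ⁿ⁾ = −Σ_{k=0}^{F_{n+2}−2} (f_n(k)/2ⁿ)·log_λ(f_n(k)/2ⁿ)`. -/
noncomputable def Hent (n : ℕ) : ℝ :=
  -∑ k ∈ Finset.range (fibF (n + 2) - 1),
      ((countRep n k : ℝ) / 2 ^ n) * Real.logb gold ((countRep n k : ℝ) / 2 ^ n)

open Filter Topology

theorem fibF_add_two (n : ℕ) : fibF (n + 2) = fibF (n + 1) + fibF n := by
  simp only [fibF]
  rw [Nat.fib_add_two (n := n + 1)]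
  ring

theorem fibF_pos (n : ℕ) : 0 < fibF n := Nat.fib_pos.2 n.succ_pos

theorem fibF_le_succ (n : ℕ) : fibF n ≤ fibF (n + 1) := Nat.fib_mono (Nat.le_succ _)

theorem countRep_zero (k : ℕ) : countRep 0 k = if k = 0 then 1 else 0 := by
  unfold countRep
  by_cases h : k = 0
  · simp [h]
  · simp [h, Ne.symm h]

theorem countRep_succ (n k : ℕ) :
    countRep (n + 1) k =
      countRep n k + if fibF (n + 1) ≤ k then countRep n (k - fibF (n + 1)) else 0 := by
  unfold countRep
  simp only [Finset.card_filter]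
  rw [← (Fin.snocEquiv fun _ => Bool).sum_comp, Fintype.sum_prod_type, Fintype.sum_bool,
    Nat.add_comm (∑ _, _)]
  simp only [Fin.snocEquiv, Equiv.coe_fn_mk, Fin.sum_univ_castSucc, Fin.snoc_castSucc,
    Fin.snoc_last, Fin.val_castSucc, Fin.val_last, if_true]
  congr 1
  split_ifs with h
  · refine Finset.sum_congr rfl fun x _ => ?_
    congr 1
    apply propext
    omega
  · refine Finset.sum_eq_zero fun x _ => ?_
    rw [if_neg]
    omega

theorem countRep_eq_zero {n k : ℕ} (h : fibF (n + 2) - 1 ≤ k) : countRep n k = 0 := by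
  induction n generalizing k with
  | zero =>
    have : fibF 2 = 2 := rfl
    rw [countRep_zero, if_neg]
    simp only [zero_add, this] at h
    omega
  | succ n ih =>
    have h1 := fibF_add_two n
    have h2 := fibF_add_two (n + 1)
    have h3 := fibF_pos (n + 1)
    have h4 := fibF_pos n
    simp only [add_assoc, Nat.reduceAdd] at h h1 h2
    rw [countRep_succ, ih (by omega)]
    split_ifs
    · rw [ih (by omega)]
    · rfl

theorem countRep_succ_of_lt {n k : ℕ} (h : k < fibF (n + 1)) :
    countRep (n + 1) k = countRep n k := by
  rw [countRep_succ, if_neg (by omega), add_zero]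

theorem countRep_succ_add (n r : ℕ) :
    countRep (n + 1) (fibF (n + 1) + r) = countRep n (fibF (n + 1) + r) + countRep n r := by
  rw [countRep_succ, if_pos (by omega), Nat.add_sub_cancel_left]

theorem countRep_eq_one (n : ℕ) :
    countRep n (fibF n - 1) = 1 ∧ countRep n (fibF (n + 1) - 1) = 1 := by
  induction n with
  | zero => simp [countRep_zero, fibF]
  | succ n ih =>
    have h1 := fibF_add_two n
    have h3 := fibF_pos (n + 1)
    have h4 := fibF_pos n
    refine ⟨by rw [countRep_succ_of_lt (by omega), ih.2], ?_⟩
    have : fibF (n + 1 + 1) - 1 = fibF (n + 1) + (fibF n - 1) := by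
      simp only [add_assoc, Nat.reduceAdd]
      omega
    rw [this, countRep_succ_add, ih.1, countRep_eq_zero (by omega)]

/-- The sum of `g` over the values of `countRep n`. -/
noncomputable def fullSum (g : ℕ → ℝ) (n : ℕ) : ℝ :=
  ∑ k ∈ Finset.range (fibF (n + 2) - 1), g (countRep n k)

/-- The sum of `g` over the values of `countRep n` on `[F_n - 1, F_{n+1} - 1]`. -/
noncomputable def midSum (g : ℕ → ℝ) (n : ℕ) : ℝ :=
  ∑ i ∈ Finset.range (fibF (n + 1) - fibF n + 1), g (countRep n (fibF n - 1 + i))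

/-- The sum of `g` over combinations with coefficients `q, p` of two overlapping
translates of `countRep n`. -/
noncomputable def pairSum (g : ℕ → ℝ) (n p q : ℕ) : ℝ :=
  ∑ r ∈ Finset.range (fibF n - 1), g (q * countRep n r + p * countRep n (fibF (n + 1) + r))

theorem pairSum_of_le_one (g : ℕ → ℝ) {n : ℕ} (hn : n ≤ 1) (p q : ℕ) : pairSum g n p q = 0 := by
  interval_cases n <;> simp [pairSum, fibF]

theorem pairSum_add_two (g : ℕ → ℝ) (n p q : ℕ) :
    pairSum g (n + 2) p q = pairSum g n p (p + q) + pairSum g n (p + q) q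
      + midSum (fun x => g ((p + q) * x)) n := by
  have h1 := fibF_add_two n
  have h2 := fibF_add_two (n + 1)
  have h3 := fibF_pos (n + 1)
  have h4 := fibF_pos n
  have h5 := fibF_le_succ n
  simp only [add_assoc, Nat.reduceAdd] at h1 h2
  have hlt : ∀ r, r < fibF (n + 1) → countRep (n + 2) r = countRep n r := fun r hr => by
    rw [countRep_succ_of_lt (by simp only [add_assoc, Nat.reduceAdd]; omega),
      countRep_succ_of_lt hr]
  have hadd : ∀ r, countRep (n + 2) (fibF (n + 2 + 1) + r)
      = countRep n (fibF (n + 1) + r) + countRep n r := fun r => by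
    have : fibF (n + 2 + 1) + r = fibF (n + 1 + 1) + (fibF (n + 1) + r) := by
      simp only [add_assoc, Nat.reduceAdd]
      omega
    rw [this, countRep_succ_add, countRep_eq_zero, zero_add, countRep_succ_add]
    simp only [add_assoc, Nat.reduceAdd]
    omega
  have hlen : fibF (n + 2) - 1 = (fibF n - 1) + (fibF (n + 1) - fibF n + 1) + (fibF n - 1) := by
    omega
  unfold pairSum midSum
  rw [hlen, Finset.sum_range_add, Finset.sum_range_add, add_right_comm]
  congr 1
  · congr 1
    · refine Finset.sum_congr rfl fun r hr => ?_
      rw [Finset.mem_range] at hr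
      rw [hadd, hlt _ (by omega)]
      congr 1
      ring
    · refine Finset.sum_congr rfl fun r hr => ?_
      rw [Finset.mem_range] at hr
      have e : fibF n - 1 + (fibF (n + 1) - fibF n + 1) + r = fibF (n + 1) + r := by omega
      rw [e, hadd, countRep_eq_zero (k := fibF (n + 1) + (fibF (n + 1) + r)) (by omega),
        countRep_succ_of_lt (by simp only [add_assoc, Nat.reduceAdd]; omega), countRep_succ_add]
      congr 1
      ring
  · refine Finset.sum_congr rfl fun r hr => ?_
    rw [Finset.mem_range] at hr
    rw [hadd, hlt _ (by omega), countRep_eq_zero (k := fibF (n + 1) + _) (by omega)]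
    congr 1
    ring

theorem midSum_succ (g : ℕ → ℝ) (n : ℕ) :
    midSum g (n + 1) = pairSum g n 1 1 + 2 * g 1 := by
  have h1 := fibF_add_two n
  have h3 := fibF_pos (n + 1)
  have h4 := fibF_pos n
  have hlen : fibF (n + 1 + 1) - fibF (n + 1) + 1 = (fibF n - 1 + 1) + 1 := by
    simp only [add_assoc, Nat.reduceAdd]
    omega
  have e1 := (countRep_eq_one (n + 1)).1
  have e2 := (countRep_eq_one (n + 1)).2
  have hend : fibF (n + 1 + 1) - 1 = fibF (n + 1) - 1 + (fibF n - 1 + 1) := by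
    simp only [add_assoc, Nat.reduceAdd]
    omega
  unfold midSum pairSum
  rw [hlen, Finset.sum_range_succ, ← hend, e2, Finset.sum_range_succ', add_zero, e1, two_mul,
    ← add_assoc]
  congr 2
  refine Finset.sum_congr rfl fun r hr => ?_
  have : fibF (n + 1) - 1 + (r + 1) = fibF (n + 1) + r := by omega
  rw [this, countRep_succ_add]
  congr 1
  ring

theorem fullSum_succ (g : ℕ → ℝ) (n : ℕ) :
    fullSum g (n + 1) = fullSum g n + midSum g n + pairSum g n 1 1 := by
  have h1 := fibF_add_two n
  have h2 := fibF_add_two (n + 1)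
  have h3 := fibF_pos (n + 1)
  have h4 := fibF_pos n
  have h5 := fibF_le_succ n
  have hlen : fibF (n + 1 + 2) - 1
      = fibF (n + 1) + (fibF n - 1) + ((fibF (n + 1) - fibF n + 1) + (fibF n - 1)) := by
    simp only [add_assoc, Nat.reduceAdd] at *
    omega
  have hlen' : fibF (n + 2) - 1 = fibF (n + 1) + (fibF n - 1) := by omega
  unfold fullSum midSum pairSum
  rw [hlen, hlen', Finset.sum_range_add _ (_ + _), Finset.sum_range_add _ (fibF (n + 1)),
    Finset.sum_range_add _ (fibF (n + 1)), Finset.sum_range_add _ (_ + 1)]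
  have a1 : ∑ x ∈ Finset.range (fibF (n + 1)), g (countRep (n + 1) x)
      = ∑ x ∈ Finset.range (fibF (n + 1)), g (countRep n x) :=
    Finset.sum_congr rfl fun r hr => by rw [countRep_succ_of_lt (Finset.mem_range.1 hr)]
  have a2 : ∑ x ∈ Finset.range (fibF n - 1), g (countRep (n + 1) (fibF (n + 1) + x))
      = ∑ r ∈ Finset.range (fibF n - 1),
        g (1 * countRep n r + 1 * countRep n (fibF (n + 1) + r)) :=
    Finset.sum_congr rfl fun r hr => by
      rw [countRep_succ_add]
      congr 1
      ring
  have hhigh : ∀ i, countRep (n + 1) (fibF (n + 1) + (fibF n - 1) + i)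
      = countRep n (fibF n - 1 + i) := fun i => by
    rw [add_assoc, countRep_succ_add, countRep_eq_zero (by omega), zero_add]
  have a3 : ∑ x ∈ Finset.range (fibF (n + 1) - fibF n + 1),
        g (countRep (n + 1) (fibF (n + 1) + (fibF n - 1) + x))
      = ∑ x ∈ Finset.range (fibF (n + 1) - fibF n + 1), g (countRep n (fibF n - 1 + x)) :=
    Finset.sum_congr rfl fun r hr => by rw [hhigh]
  have a4 : ∑ x ∈ Finset.range (fibF n - 1), g (countRep (n + 1)
        (fibF (n + 1) + (fibF n - 1) + (fibF (n + 1) - fibF n + 1 + x)))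
      = ∑ x ∈ Finset.range (fibF n - 1), g (countRep n (fibF (n + 1) + x)) :=
    Finset.sum_congr rfl fun r hr => by
      rw [hhigh]
      congr 2
      omega
  rw [a1, a2, a3, a4]
  ring

theorem sum_range_countRep {n N : ℕ} (hN : fibF (n + 2) - 1 ≤ N) :
    ∑ k ∈ Finset.range N, countRep n k = 2 ^ n := by
  induction n generalizing N with
  | zero =>
    have : fibF 2 = 2 := rfl
    simp only [zero_add, this] at hN
    simp only [countRep_zero, Finset.sum_ite_eq', Finset.mem_range, pow_zero]
    rw [if_pos (by omega)]
  | succ n ih =>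
    have h1 := fibF_add_two n
    have h2 := fibF_add_two (n + 1)
    have h3 := fibF_pos (n + 1)
    have h4 := fibF_pos n
    simp only [add_assoc, Nat.reduceAdd] at hN h1 h2
    obtain ⟨M, rfl⟩ : ∃ M, N = fibF (n + 1) + M := ⟨N - fibF (n + 1), by omega⟩
    simp only [countRep_succ, Finset.sum_add_distrib]
    rw [ih (by omega), Finset.sum_range_add, Finset.sum_eq_zero, zero_add]
    · simp only [le_add_iff_nonneg_right, zero_le, if_true, Nat.add_sub_cancel_left]
      rw [ih (by omega)]
      ring
    · intro x hx
      rw [if_neg (by simpa using hx)]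

theorem fullSum_cast (n : ℕ) : fullSum (fun x => (x : ℝ)) n = 2 ^ n := by
  simp only [fullSum]
  exact_mod_cast sum_range_countRep le_rfl

/-- The pair `(p, q)` with `p/q = [a_1, …, a_t]`. -/
def cfPair : List ℕ → ℕ × ℕ
  | [] => (0, 1)
  | a :: t => ((cfPair t).2, a * (cfPair t).2 + (cfPair t).1)

theorem cf_eq_cfPair (l : List ℕ) (hl : ∀ x ∈ l, 0 < x) :
    0 < (cfPair l).2 ∧ (cfPair l).1.Coprime (cfPair l).2 ∧
      cf l = ((cfPair l).1 : ℚ) / (cfPair l).2 := by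
  induction l with
  | nil => simp [cfPair, cf]
  | cons a t ih =>
    obtain ⟨h1, h2, h3⟩ := ih fun x hx => hl x (List.mem_cons_of_mem _ hx)
    have ha := hl a List.mem_cons_self
    have hpos : 0 < a * (cfPair t).2 + (cfPair t).1 := Nat.add_pos_left (Nat.mul_pos ha h1) _
    refine ⟨hpos, ?_, ?_⟩
    · simp only [cfPair]
      rw [Nat.add_comm, Nat.coprime_add_mul_right_right]
      exact h2.symm
    · simp only [cfPair, cf, h3]
      have h1' : ((cfPair t).2 : ℚ) ≠ 0 := by positivity
      have hpos' : ((a * (cfPair t).2 + (cfPair t).1 : ℕ) : ℚ) ≠ 0 := by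
        exact_mod_cast hpos.ne'
      push_cast at hpos' ⊢
      field_simp

theorem pqSum_eq_cfPair (l : List ℕ) (hl : ∀ x ∈ l, 0 < x) :
    pqSum l = (cfPair l).1 + (cfPair l).2 := by
  obtain ⟨h1, h2, h3⟩ := cf_eq_cfPair l hl
  have hd : (0 : ℤ) < (cfPair l).2 := by exact_mod_cast h1
  have hn := Rat.num_div_eq_of_coprime (a := (cfPair l).1) (b := (cfPair l).2) hd (by simpa using h2)
  have hq := Rat.den_div_eq_of_coprime (a := (cfPair l).1) (b := (cfPair l).2) hd (by simpa using h2)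
  push_cast at hn hq
  unfold pqSum
  rw [h3, hn]
  zify
  rw [hq]
  simp

/-- Increases the first entry of a list. -/
def incHead : List ℕ → List ℕ
  | [] => []
  | a :: t => (a + 1) :: t

/-- The compositions of `n + 1`. -/
def comps : ℕ → Finset (List ℕ)
  | 0 => {[1]}
  | n + 1 => (comps n).image (List.cons 1) ∪ (comps n).image incHead

theorem mem_comps (n : ℕ) (l : List ℕ) :
    l ∈ comps n ↔ l.sum = n + 1 ∧ ∀ x ∈ l, 0 < x := by
  induction n generalizing l with
  | zero =>
    simp only [comps, Finset.mem_singleton]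
    refine ⟨fun h => by simp [h], fun ⟨h, h'⟩ => ?_⟩
    match l, h, h' with
    | [a], h, h' => simp at h; simp [h]
    | a :: b :: t, h, h' =>
      have ha := h' a (by simp)
      have hb := h' b (by simp)
      simp at h
      omega
  | succ n ih =>
    simp only [comps, Finset.mem_union, Finset.mem_image, ih]
    constructor
    · rintro (⟨t, ⟨h, h'⟩, rfl⟩ | ⟨t, ⟨h, h'⟩, rfl⟩)
      · refine ⟨by simp [h, add_comm], fun x hx => ?_⟩
        rcases List.mem_cons.1 hx with rfl | hx
        · exact one_pos
        · exact h' x hx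
      · match t, h, h' with
        | a :: t, h, h' =>
          refine ⟨?_, fun x hx => ?_⟩
          · simp only [incHead, List.sum_cons] at h ⊢
            omega
          · rcases List.mem_cons.1 hx with rfl | hx
            · exact Nat.succ_pos _
            · exact h' x (List.mem_cons_of_mem _ hx)
    · rintro ⟨h, h'⟩
      match l, h, h' with
      | 0 :: t, h, h' => exact absurd (h' 0 List.mem_cons_self) (lt_irrefl _)
      | 1 :: t, h, h' =>
        refine Or.inl ⟨t, ⟨?_, fun x hx => h' x (List.mem_cons_of_mem _ hx)⟩, rfl⟩
        simp only [List.sum_cons] at h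
        omega
      | (a + 2) :: t, h, h' =>
        refine Or.inr ⟨(a + 1) :: t, ⟨?_, fun x hx => ?_⟩, rfl⟩
        · simp only [List.sum_cons] at h ⊢
          omega
        · rcases List.mem_cons.1 hx with rfl | hx
          · exact Nat.succ_pos _
          · exact h' x (List.mem_cons_of_mem _ hx)

theorem sum_comps_succ (n : ℕ) (f : List ℕ → ℝ) :
    ∑ l ∈ comps (n + 1), f l = ∑ l ∈ comps n, (f (1 :: l) + f (incHead l)) := by
  have hinc : ∀ l ∈ comps n, ∃ a t, l = (a + 1) :: t := fun l hl => by
    obtain ⟨h, h'⟩ := (mem_comps n l).1 hl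
    match l, h, h' with
    | 0 :: t, h, h' => exact absurd (h' 0 List.mem_cons_self) (lt_irrefl _)
    | (a + 1) :: t, h, h' => exact ⟨a, t, rfl⟩
  rw [comps, Finset.sum_union, Finset.sum_image, Finset.sum_image, Finset.sum_add_distrib]
  · intro x hx y hy hxy
    obtain ⟨a, t, rfl⟩ := hinc x hx
    obtain ⟨b, s, rfl⟩ := hinc y hy
    simpa [incHead] using hxy
  · intro x _ y _ hxy
    simpa using hxy
  · rw [Finset.disjoint_left]
    intro l hl hl'
    obtain ⟨x, hx, rfl⟩ := Finset.mem_image.1 hl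
    obtain ⟨y, hy, hxy⟩ := Finset.mem_image.1 hl'
    obtain ⟨b, s, rfl⟩ := hinc y hy
    simp [incHead] at hxy

/-- The sum of `g (p' + q')` over the `j`-th descendants `(p', q')` of `(p, q)`, the children
of `(p, q)` being `(p, p + q)` and `(q, p + q)`. -/
def treeSum (g : ℕ → ℝ) : ℕ → ℕ → ℕ → ℝ
  | 0, p, q => g (p + q)
  | j + 1, p, q => treeSum g j p (p + q) + treeSum g j q (p + q)

theorem treeSum_comm (g : ℕ → ℝ) (j p q : ℕ) : treeSum g j p q = treeSum g j q p := by
  cases j with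
  | zero => simp [treeSum, add_comm]
  | succ j => simp only [treeSum]; rw [add_comm, add_comm p q]

theorem sum_comps_treeSum (g : ℕ → ℝ) (n j : ℕ) :
    ∑ l ∈ comps n, treeSum g j (cfPair l).1 (cfPair l).2 = treeSum g (n + j) 1 1 := by
  induction n generalizing j with
  | zero => simp [comps, cfPair]
  | succ n ih =>
    rw [sum_comps_succ, add_right_comm, add_assoc n, ← ih]
    refine Finset.sum_congr rfl fun l hl => ?_
    match l, (mem_comps n l).1 hl with
    | a :: t, _ =>
      simp only [treeSum, cfPair, incHead]
      rw [add_comm]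
      congr 2 <;> ring

/-- The function `x ↦ x log_λ x`. -/
noncomputable def xlog (x : ℕ) : ℝ := x * Real.logb gold x

theorem kcoef_succ (n : ℕ) : kcoef (n + 1) = treeSum xlog n 1 1 := by
  have hset : {l : List ℕ | l.sum = n + 1 ∧ ∀ x ∈ l, 0 < x} = (comps n : Set (List ℕ)) := by
    ext l
    simp only [Set.mem_ofPred_eq, SetLike.mem_coe, mem_comps]
  have h : kcoef (n + 1) = ∑' a : {l : List ℕ | l.sum = n + 1 ∧ ∀ x ∈ l, 0 < x},
    xlog (pqSum a) := rfl
  rw [h, hset, Finset.tsum_subtype' (comps n) fun l => xlog (pqSum l)]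
  refine Eq.trans ?_ (sum_comps_treeSum xlog n 0)
  refine Finset.sum_congr rfl fun l hl => ?_
  rw [pqSum_eq_cfPair l ((mem_comps n l).1 hl).2]
  rfl

theorem tendsto_of_tendsto_add_mul {y : ℕ → ℝ} {c L : ℝ} (hc : |c| < 1)
    (h : Tendsto (fun n => y (n + 1) + c * y n) atTop (𝓝 L)) :
    Tendsto y atTop (𝓝 (L / (1 + c))) := by
  have hc0 : 0 < 1 + c := by linarith [(abs_lt.1 hc).1]
  have hc1 : 0 < 1 - |c| := by linarith
  set M := L / (1 + c) with hM
  have hL : L = M + c * M := by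
    rw [hM]
    field_simp
  rw [Metric.tendsto_atTop] at h ⊢
  intro ε hε
  obtain ⟨N, hN⟩ := h (ε / 2 * (1 - |c|)) (by positivity)
  have hind : ∀ k, |y (N + k) - M| ≤ |c| ^ k * |y N - M| + ε / 2 := by
    intro k
    induction k with
    | zero =>
      simp only [add_zero, pow_zero, one_mul]
      linarith
    | succ k ih =>
      have h1 := hN (N + k) (by omega)
      rw [Real.dist_eq] at h1
      have e : y (N + (k + 1)) - M
          = (y (N + k + 1) + c * y (N + k) - L) + -c * (y (N + k) - M) := by
        rw [hL, ← add_assoc]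
        ring
      rw [e]
      refine (abs_add_le _ _).trans ?_
      rw [abs_mul, abs_neg, pow_succ]
      nlinarith [mul_le_mul_of_nonneg_left ih (abs_nonneg c)]
  have hlim : Tendsto (fun k => |c| ^ k * |y N - M|) atTop (𝓝 (0 * |y N - M|)) :=
    (tendsto_pow_atTop_nhds_zero_of_lt_one (abs_nonneg c) hc).mul_const _
  rw [zero_mul] at hlim
  obtain ⟨K, hK⟩ := eventually_atTop.1 (hlim.eventually_lt_const (half_pos hε))
  refine ⟨N + K, fun n hn => ?_⟩
  obtain ⟨k, rfl⟩ := Nat.exists_eq_add_of_le (show N ≤ n by omega)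
  rw [Real.dist_eq]
  linarith [hind k, hK k (by omega)]

theorem tendsto_of_recurrence {s d : ℕ → ℝ} {L : ℝ}
    (h : ∀ n, s (n + 3) = 3 * s (n + 1) + 2 * s n + (d (n + 2) - 3 * d n))
    (hd : Tendsto (fun n => d n / 2 ^ n) atTop (𝓝 L)) :
    Tendsto (fun n => (s (n + 1) - 2 * s n) / 2 ^ n) atTop (𝓝 (L / 9)) := by
  set u : ℕ → ℝ := fun n => (s (n + 1) - 2 * s n) / 2 ^ n with hu
  have h1 : Tendsto (fun n => (u (n + 1 + 1) + 1 / 2 * u (n + 1))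
      + 1 / 2 * (u (n + 1) + 1 / 2 * u n)) atTop (𝓝 (L - 3 / 4 * L)) := by
    refine (((tendsto_add_atTop_iff_nat 2).2 hd).sub (hd.const_mul (3 / 4))).congr fun n => ?_
    have := h n
    simp only [hu, add_assoc, Nat.reduceAdd, pow_succ]
    rw [this]
    field_simp
    ring
  have hhalf : |(1 / 2 : ℝ)| < 1 := by norm_num [abs_lt]
  have h2 := tendsto_of_tendsto_add_mul hhalf
    (tendsto_of_tendsto_add_mul (y := fun n => u (n + 1) + 1 / 2 * u n) hhalf h1)
  convert h2 using 2
  ring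

theorem tendsto_div_of_sub {v : ℕ → ℝ} {L : ℝ}
    (h : Tendsto (fun n => v (n + 1) - v n) atTop (𝓝 L)) :
    Tendsto (fun n : ℕ => v n / n) atTop (𝓝 L) := by
  have h1 := h.cesaro.add (tendsto_const_div_atTop_nhds_zero_nat (v 0))
  rw [add_zero] at h1
  refine h1.congr fun n => ?_
  rw [Finset.sum_range_sub]
  ring

theorem tendsto_fullSum_of_recurrence {S s d : ℕ → ℝ} {L : ℝ}
    (hS : ∀ n, S (n + 1) = S n + s n + s (n + 1))
    (h : ∀ n, s (n + 3) = 3 * s (n + 1) + 2 * s n + (d (n + 2) - 3 * d n))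
    (hd : Tendsto (fun n => d n / 2 ^ n) atTop (𝓝 L)) :
    Tendsto (fun n : ℕ => S n / 2 ^ n / n) atTop (𝓝 (L / 6)) := by
  have hu := tendsto_of_recurrence h hd
  have hv : Tendsto (fun n : ℕ => s n / 2 ^ n / n) atTop (𝓝 (L / 9 / 2)) := by
    refine tendsto_div_of_sub (v := fun n => s n / 2 ^ n) ((hu.div_const 2).congr fun n => ?_)
    rw [pow_succ]
    field_simp
  have hZ : Tendsto (fun n => (S n - 3 * s n) / 2 ^ n) atTop (𝓝 (-(L / 9) / (1 + -(1 / 2)))) := by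
    refine tendsto_of_tendsto_add_mul (by norm_num [abs_lt]) (hu.neg.congr fun n => ?_)
    rw [hS, pow_succ]
    field_simp
    ring
  have := (hv.const_mul 3).add (hZ.mul (tendsto_inv_atTop_nhds_zero_nat (𝕜 := ℝ)))
  convert this using 2
  · ring
  · ring

theorem one_lt_gold : 1 < gold := by
  unfold gold
  have : (1 : ℝ) < Real.sqrt 5 := by
    rw [Real.lt_sqrt] <;> norm_num
  linarith

theorem xlog_mul (a b : ℕ) : xlog (a * b) = xlog a * b + a * xlog b := by
  unfold xlog
  rcases eq_or_ne a 0 with rfl | ha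
  · simp
  rcases eq_or_ne b 0 with rfl | hb
  · simp
  push_cast
  rw [Real.logb_mul (by positivity) (by positivity)]
  ring

theorem midSum_xlog_mul (c n : ℕ) : midSum (fun x => xlog (c * x)) n
    = xlog c * midSum (fun x => (x : ℝ)) n + c * midSum xlog n := by
  simp only [midSum, xlog_mul, Finset.sum_add_distrib, Finset.mul_sum]

/-- The sequence `u` delayed by two steps. -/
noncomputable def delay (u : ℕ → ℝ) (n : ℕ) : ℝ := if 2 ≤ n then u (n - 2) else 0

/-- The solution of `c (n + 2) = u n + 3 * c n` with `c 0 = c 1 = 0`. -/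
noncomputable def tripling (u : ℕ → ℝ) : ℕ → ℝ
  | 0 => 0
  | 1 => 0
  | n + 2 => u n + 3 * tripling u n

theorem pairSum_xlog (N n p q : ℕ) (hn : n ≤ 2 * N + 1) :
    pairSum xlog n p q
      = ∑ j ∈ Finset.range N, treeSum xlog j p q * delay (midSum fun x => (x : ℝ)) (n - 2 * j)
        + (p + q) * tripling (midSum xlog) n := by
  induction N generalizing n p q with
  | zero =>
    rw [pairSum_of_le_one _ (by omega)]
    have : n ≤ 1 := by omega
    interval_cases n <;> simp [tripling]
  | succ N ih =>
    match n, hn with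
    | 0, _ => simp [pairSum_of_le_one, tripling, delay]
    | 1, _ =>
      rw [pairSum_of_le_one _ le_rfl, Finset.sum_eq_zero]
      · simp [tripling]
      · intro j _
        rw [delay, if_neg (by omega), mul_zero]
    | n + 2, hn =>
      rw [pairSum_add_two, ih n _ _ (by omega), ih n _ _ (by omega), midSum_xlog_mul,
        Finset.sum_range_succ']
      have e : ∀ j, n + 2 - 2 * (j + 1) = n - 2 * j := fun j => by omega
      simp only [e, treeSum, add_mul, Finset.sum_add_distrib, treeSum_comm xlog _ (p + q) q]
      simp only [delay, tripling, mul_zero, Nat.sub_zero, Nat.le_add_left, if_true,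
        Nat.add_sub_cancel]
      push_cast
      ring

theorem treeSum_xlog_nonneg (j p q : ℕ) : 0 ≤ treeSum xlog j p q := by
  induction j generalizing p q with
  | zero =>
    refine mul_nonneg (Nat.cast_nonneg _) ?_
    rcases Nat.eq_zero_or_pos (p + q) with h | h
    · simp [h]
    · exact Real.logb_nonneg one_lt_gold (by exact_mod_cast h)
  | succ j ih => exact add_nonneg (ih _ _) (ih _ _)

theorem treeSum_xlog_le (j p q : ℕ) (h : 0 < p + q) :
    treeSum xlog j p q ≤ 3 ^ j * (p + q) * Real.logb gold (2 ^ j * (p + q)) := by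
  induction j generalizing p q with
  | zero => simp [treeSum, xlog]
  | succ j ih =>
    have h' : (0 : ℝ) < p + q := by exact_mod_cast h
    have hp : (0 : ℝ) ≤ p := Nat.cast_nonneg p
    have hq : (0 : ℝ) ≤ q := Nat.cast_nonneg q
    have key : ∀ a : ℕ, (a : ℝ) ≤ p + q →
        treeSum xlog j a (p + q)
          ≤ 3 ^ j * (a + (p + q)) * Real.logb gold (2 ^ (j + 1) * (p + q)) := fun a ha => by
      have ha0 : (0 : ℝ) ≤ a := Nat.cast_nonneg a
      refine (ih a (p + q) (by omega)).trans ?_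
      push_cast
      refine mul_le_mul_of_nonneg_left ?_ (by positivity)
      refine Real.logb_le_logb_of_le one_lt_gold (by positivity) ?_
      rw [pow_succ, mul_assoc]
      exact mul_le_mul_of_nonneg_left (by linarith) (by positivity)
    refine (add_le_add (key p (by linarith)) (key q (by linarith))).trans (le_of_eq ?_)
    ring

theorem summable_treeSum : Summable fun j => treeSum xlog j 1 1 / 4 ^ j := by
  have h1 := summable_pow_mul_geometric_of_norm_lt_one 1 (r := (3 / 4 : ℝ))
    (by rw [Real.norm_eq_abs, abs_lt]; norm_num)
  have h0 := summable_pow_mul_geometric_of_norm_lt_one 0 (r := (3 / 4 : ℝ))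
    (by rw [Real.norm_eq_abs, abs_lt]; norm_num)
  refine Summable.of_nonneg_of_le (fun j => div_nonneg (treeSum_xlog_nonneg _ _ _) (by positivity))
    (fun j => ?_) ((h1.add h0).mul_left (2 * Real.logb gold 2))
  rw [div_le_iff₀ (by positivity)]
  refine (treeSum_xlog_le j 1 1 (by norm_num)).trans (le_of_eq ?_)
  have : (2 : ℝ) ^ j * ((1 : ℕ) + (1 : ℕ)) = 2 ^ (j + 1) := by
    rw [pow_succ]
    norm_num
  rw [this, Real.logb_pow, div_pow]
  push_cast
  field_simp
  ring

theorem midSum_cast_add (n : ℕ) : midSum (fun x => (x : ℝ)) (n + 1) + midSum (fun x => (x : ℝ)) n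
    = 2 ^ n + 2 := by
  have h1 := fullSum_succ (fun x => (x : ℝ)) n
  have h2 := midSum_succ (fun x => (x : ℝ)) n
  rw [fullSum_cast, fullSum_cast, pow_succ] at h1
  push_cast at h2
  linarith

theorem midSum_cast_nonneg (n : ℕ) : 0 ≤ midSum (fun x => (x : ℝ)) n :=
  Finset.sum_nonneg fun _ _ => Nat.cast_nonneg _

theorem tendsto_midSum_cast :
    Tendsto (fun n => midSum (fun x => (x : ℝ)) n / 2 ^ n) atTop (𝓝 (1 / 3)) := by
  have h : Tendsto (fun n : ℕ => 1 / 2 + (1 / 2 : ℝ) ^ n) atTop (𝓝 (1 / 2 + 0)) :=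
    (tendsto_pow_atTop_nhds_zero_of_lt_one (by norm_num) (by norm_num)).const_add _
  have := tendsto_of_tendsto_add_mul (y := fun n => midSum (fun x => (x : ℝ)) n / 2 ^ n)
    (c := 1 / 2) (by norm_num [abs_lt]) (h.congr fun n => ?_)
  · convert this using 2
    norm_num
  · rw [eq_sub_of_add_eq (midSum_cast_add n), pow_succ, one_div_pow]
    field_simp
    ring

theorem delay_midSum_le (n j : ℕ) :
    delay (midSum fun x => (x : ℝ)) (n - 2 * j) / 2 ^ n ≤ 3 / 4 ^ j := by
  unfold delay
  split_ifs with h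
  · obtain ⟨m, rfl⟩ : ∃ m, n = m + 2 + 2 * j := ⟨n - 2 - 2 * j, by omega⟩
    have e : m + 2 + 2 * j - 2 * j - 2 = m := by omega
    have h1 := midSum_cast_add m
    have h2 := midSum_cast_nonneg (m + 1)
    have h3 : (1 : ℝ) ≤ 2 ^ m := one_le_pow₀ (by norm_num)
    rw [e, div_le_div_iff₀ (by positivity) (by positivity), pow_add, pow_add, pow_mul]
    norm_num
    have h4 : (0 : ℝ) < 4 ^ j := by positivity
    nlinarith
  · rw [zero_div]
    positivity

theorem delay_midSum_nonneg (n : ℕ) : 0 ≤ delay (midSum fun x => (x : ℝ)) n := by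
  unfold delay
  split_ifs
  · exact midSum_cast_nonneg _
  · exact le_rfl

theorem tendsto_delay_midSum (j : ℕ) :
    Tendsto (fun n => delay (midSum fun x => (x : ℝ)) (n - 2 * j) / 2 ^ n) atTop
      (𝓝 (1 / 12 / 4 ^ j)) := by
  rw [← tendsto_add_atTop_iff_nat (2 + 2 * j)]
  have h := tendsto_midSum_cast.mul_const (1 / 4 / 4 ^ j)
  convert h using 2 with n
  · have e : n + (2 + 2 * j) - 2 * j - 2 = n := by omega
    rw [delay, if_pos (by omega), e, pow_add, pow_add, pow_mul]
    norm_num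
    field_simp
  · ring

theorem tendsto_sum_treeSum_delay :
    Tendsto (fun n => (∑ j ∈ Finset.range n,
        treeSum xlog j 1 1 * delay (midSum fun x => (x : ℝ)) (n - 2 * j)) / 2 ^ n) atTop
      (𝓝 ((∑' j, treeSum xlog j 1 1 / 4 ^ j) / 12)) := by
  have h := tendsto_tsum_of_dominated_convergence (𝓕 := atTop)
    (f := fun n j => treeSum xlog j 1 1 * (delay (midSum fun x => (x : ℝ)) (n - 2 * j) / 2 ^ n))
    (g := fun j => treeSum xlog j 1 1 * (1 / 12 / 4 ^ j))
    (summable_treeSum.mul_left 3) (fun j => (tendsto_delay_midSum j).const_mul _)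
    (Eventually.of_forall fun n j => ?_)
  · convert h using 2 with n
    · rw [tsum_eq_sum (s := Finset.range n), Finset.sum_div]
      · exact Finset.sum_congr rfl fun j _ => by ring
      · intro j hj
        rw [Finset.mem_range] at hj
        rw [delay, if_neg (by omega), zero_div, mul_zero]
    · rw [← tsum_div_const]
      exact congrArg tsum (funext fun j => by ring)
  · rw [Real.norm_of_nonneg (mul_nonneg (treeSum_xlog_nonneg _ _ _)
      (div_nonneg (delay_midSum_nonneg _) (by positivity)))]
    refine (mul_le_mul_of_nonneg_left (delay_midSum_le n j) (treeSum_xlog_nonneg _ _ _)).trans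
      (le_of_eq ?_)
    ring

theorem tendsto_fullSum_xlog :
    Tendsto (fun n : ℕ => fullSum xlog n / 2 ^ n / n) atTop
      (𝓝 ((∑' j, treeSum xlog j 1 1 / 4 ^ j) / 12 / 6)) := by
  have hone : xlog 1 = 0 := by simp [xlog]
  have hmid : ∀ n, midSum xlog (n + 1) = pairSum xlog n 1 1 := fun n => by
    rw [midSum_succ, hone, mul_zero, add_zero]
  refine tendsto_fullSum_of_recurrence (s := midSum xlog) (fun n => ?_) (fun n => ?_)
    tendsto_sum_treeSum_delay
  · rw [fullSum_succ, hmid]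
  · rw [hmid, hmid, pairSum_xlog (n + 2) _ _ _ (by omega), pairSum_xlog n _ _ _ (by omega)]
    simp only [tripling]
    push_cast
    ring

theorem Hent_eq (n : ℕ) : Hent n = n * Real.logb gold 2 - fullSum xlog n / 2 ^ n := by
  have h : ∀ x : ℕ, (x : ℝ) / 2 ^ n * Real.logb gold (x / 2 ^ n)
      = xlog x / 2 ^ n - (x : ℝ) / 2 ^ n * (n * Real.logb gold 2) := fun x => by
    rcases eq_or_ne x 0 with rfl | hx
    · simp [xlog]
    · rw [Real.logb_div (by positivity) (by positivity), Real.logb_pow, xlog]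
      ring
  have h1 := fullSum_cast n
  unfold fullSum at h1
  unfold Hent fullSum
  simp only [h]
  rw [Finset.sum_sub_distrib, ← Finset.sum_mul, ← Finset.sum_div, ← Finset.sum_div, h1,
    div_self (by positivity)]
  ring

open Filter in
/-- Alexander–Zagier's formula: `H_μ = lim H⁽ⁿ⁾/n` exists and equals
`log_λ 2 − (1/18) Σ_{n≥1} k_n 4^{−n}`. -/
theorem alexander_zagier :
    Tendsto (fun n : ℕ => Hent n / n) atTop
      (nhds (Real.logb gold 2 - (1 / 18) * ∑' n : ℕ, kcoef (n + 1) / 4 ^ (n + 1))) := by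
  have h := tendsto_fullSum_xlog.const_sub (Real.logb gold 2)
  have hlim : (∑' j, treeSum xlog j 1 1 / 4 ^ j) / 12 / 6
      = (1 / 18) * ∑' n : ℕ, kcoef (n + 1) / 4 ^ (n + 1) := by
    have : ∀ n, kcoef (n + 1) / 4 ^ (n + 1) = treeSum xlog n 1 1 / 4 ^ n / 4 := fun n => by
      rw [kcoef_succ, pow_succ, div_div]
    simp only [this]
    rw [tsum_div_const]
    ring
  rw [← hlim]
  refine h.congr' ?_
  filter_upwards [eventually_ne_atTop 0] with n hn
  have hn' : (n : ℝ) ≠ 0 := Nat.cast_ne_zero.2 hn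
  rw [Hent_eq, sub_div, mul_div_cancel_left₀ _ hn']
end
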